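/- arXiv:2112.14720 — 2 statements merged into one kernel-verified Lean document; each statement's English description precedes it below -/
import Mathlib

section
/- (Holonomic approximation by multi-sections over the circle; Theorem 7.2 of del Pino–Toussaint for X = S¹ and the trivial bundle S¹ × ℝ^ℓ, in elementary form.) Fix integers ℓ ≥ 1, r ≥ 1 and ε > 0. Let σ_0, …, σ_r : ℝ → ℝ^ℓ be continuous 1-periodic maps. Then there exist a smooth function x : ℝ → ℝ with x(t+1) = x(t) + 1 for all t, and smooth 1-periodic maps z_0, …, z_r : ℝ → ℝ^ℓ, such that: (a) integrality: deriv z_i t = (deriv x t) • z_{i+1}(t) for all 0 ≤ i < r and all t; (b) the set {t : deriv x t ≠ 0} is dense in ℝ; (c) the front is injective modulo ℤ: if x(t) = x(s) + k for some k ∈ ℤ and z_0(t) = z_0(s), then t = s + k; (d) |x(t) − t| < ε and ‖z_i(t) − σ_i(t)‖ < ε for all t and all 0 ≤ i ≤ r. -/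
noncomputable section

abbrev Vec (ℓ : ℕ) := Fin ℓ → ℝ

/-- coefficient-wise chain condition at index `i`. -/
def ChainAt (u : ℝ → ℝ) (f : ℝ → PowerSeries ℝ) (i : ℕ) : Prop :=
  ∀ t, HasDerivAt (fun t => PowerSeries.coeff i (f t))
    (u t * PowerSeries.coeff i (PowerSeries.derivative ℝ (f t))) t

lemma ChainAt.mul {u : ℝ → ℝ} {f g : ℝ → PowerSeries ℝ} {i : ℕ}
    (hf : ∀ j ≤ i, ChainAt u f j) (hg : ∀ j ≤ i, ChainAt u g j) :
    ChainAt u (fun t => f t * g t) i := by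
  intro t
  have h : HasDerivAt (fun t => ∑ p ∈ Finset.HasAntidiagonal.antidiagonal i,
      PowerSeries.coeff p.1 (f t) * PowerSeries.coeff p.2 (g t))
      (∑ p ∈ Finset.HasAntidiagonal.antidiagonal i,
        ((u t * PowerSeries.coeff p.1 (PowerSeries.derivative ℝ (f t))) *
          PowerSeries.coeff p.2 (g t) + PowerSeries.coeff p.1 (f t) *
          (u t * PowerSeries.coeff p.2 (PowerSeries.derivative ℝ (g t))))) t := by
    apply HasDerivAt.fun_sum
    intro p hp
    have := Finset.HasAntidiagonal.mem_antidiagonal.1 hp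
    exact (hf p.1 (by omega) t).mul (hg p.2 (by omega) t)
  simp only [PowerSeries.coeff_mul]
  convert h using 1
  rw [Derivation.leibniz, map_add, smul_eq_mul, smul_eq_mul, mul_comm (g t), PowerSeries.coeff_mul,
    PowerSeries.coeff_mul, Finset.sum_add_distrib, mul_add, Finset.mul_sum, Finset.mul_sum, add_comm]
  congr 1 <;> refine Finset.sum_congr rfl fun p _ => by ring

lemma ChainAt.deriv {u : ℝ → ℝ} {f : ℝ → PowerSeries ℝ} {i : ℕ}
    (hf : ChainAt u f (i + 1)) : ChainAt u (fun t => PowerSeries.derivative ℝ (f t)) i := by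
  intro t
  have := (hf t).mul_const ((i : ℝ) + 1)
  simp only [PowerSeries.coeff_derivative] at this ⊢
  refine this.congr_deriv ?_
  push_cast
  ring

lemma ChainAt.add {u : ℝ → ℝ} {f g : ℝ → PowerSeries ℝ} {i : ℕ}
    (hf : ChainAt u f i) (hg : ChainAt u g i) : ChainAt u (fun t => f t + g t) i := by
  intro t
  simp only [map_add, mul_add]
  exact (hf t).add (hg t)

lemma ChainAt.sub {u : ℝ → ℝ} {f g : ℝ → PowerSeries ℝ} {i : ℕ}
    (hf : ChainAt u f i) (hg : ChainAt u g i) : ChainAt u (fun t => f t - g t) i := by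
  intro t
  simp only [map_sub, mul_sub]
  exact (hf t).sub (hg t)

lemma ChainAt.const {u : ℝ → ℝ} {c : ℝ} {i : ℕ} :
    ChainAt u (fun _ => PowerSeries.C c) i := by
  intro t
  simpa using hasDerivAt_const t (PowerSeries.coeff i (PowerSeries.C c))

lemma ChainAt.sum {u : ℝ → ℝ} {ι : Type*} {A : Finset ι} {f : ι → ℝ → PowerSeries ℝ} {i : ℕ}
    (hf : ∀ k ∈ A, ChainAt u (f k) i) : ChainAt u (fun t => ∑ k ∈ A, f k t) i := by
  intro t
  simp only [map_sum, Finset.mul_sum]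
  exact HasDerivAt.fun_sum fun k hk => hf k hk t

lemma ChainAt.pow {u : ℝ → ℝ} {f : ℝ → PowerSeries ℝ} {i : ℕ}
    (hf : ∀ j ≤ i, ChainAt u f j) (k : ℕ) : ∀ j ≤ i, ChainAt u (fun t => f t ^ k) j := by
  induction k with
  | zero => intro j _; simpa using ChainAt.const (u := u) (c := 1) (i := j)
  | succ k ih =>
    intro j hj
    simp only [pow_succ]
    exact ChainAt.mul (fun a ha => ih a (ha.trans hj)) (fun a ha => hf a (ha.trans hj))

/-- coefficients of the composition of a smooth function with a formal series. -/
noncomputable def qc : ℕ → (ℝ → ℝ) → (ℕ → ℝ) → ℝ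
  | 0, s, S => s (S 0)
  | (i + 1), s, S =>
    (∑ a : Fin (i + 1), qc a (deriv s) S * (S (i - a + 1) * ((i - a : ℕ) + 1))) / (i + 1)

noncomputable def Qs (s : ℝ → ℝ) (S : ℕ → ℝ) : PowerSeries ℝ := PowerSeries.mk fun i => qc i s S

lemma Qs_succ (i : ℕ) (s : ℝ → ℝ) (S : ℕ → ℝ) :
    PowerSeries.coeff i (PowerSeries.derivative ℝ (Qs s S)) =
      PowerSeries.coeff i (Qs (deriv s) S * PowerSeries.derivative ℝ (PowerSeries.mk S)) := by
  rw [PowerSeries.coeff_derivative, PowerSeries.coeff_mul,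
    Finset.Nat.sum_antidiagonal_eq_sum_range_succ_mk, Finset.sum_range]
  simp only [Qs, PowerSeries.coeff_mk, PowerSeries.coeff_derivative]
  rw [qc, div_mul_cancel₀ _ (by positivity)]

lemma Qs_chain {u : ℝ → ℝ} {a : ℕ → ℝ → ℝ} {r : ℕ}
    (ha : ∀ i < r, ChainAt u (fun t => PowerSeries.mk fun i => a i t) i) :
    ∀ i < r, ∀ s : ℝ → ℝ, ContDiff ℝ (⊤ : ℕ∞) s →
      ChainAt u (fun t => Qs s (fun i => a i t)) i := by
  intro i
  induction i using Nat.strong_induction_on with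
  | _ i ih =>
  intro hi s hs
  cases i with
  | zero =>
    intro t
    rw [Qs_succ]
    have h1 := ha 0 hi t
    simp only [PowerSeries.coeff_mk] at h1
    have h2 := ((hs.differentiable (by simp)) (a 0 t)).hasDerivAt.comp t h1
    simp only [Qs, PowerSeries.coeff_mk, qc]
    refine h2.congr_deriv ?_
    rw [PowerSeries.coeff_mul]
    simp [qc]
    ring
  | succ i =>
    intro t
    have hs' : ContDiff ℝ (⊤ : ℕ∞) (deriv s) := (contDiff_infty_iff_deriv.1 hs).2
    have h1 : ChainAt u (fun t => Qs (deriv s) (fun i => a i t) *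
        PowerSeries.derivative ℝ (PowerSeries.mk fun i => a i t)) i :=
      ChainAt.mul (fun j hj => ih j (by omega) (by omega) _ hs')
        (fun j hj => (ha (j + 1) (by omega)).deriv)
    have h2 := (h1 t).div_const ((i : ℝ) + 1)
    simp only [← Qs_succ] at h2
    simp only [PowerSeries.coeff_derivative _ i] at h2
    have hne : (i : ℝ) + 1 ≠ 0 := by positivity
    simp only [mul_div_cancel_right₀ _ hne] at h2
    refine h2.congr_deriv ?_
    rw [← Qs_succ, mul_div_assoc, mul_div_cancel_right₀ _ hne]

lemma Qs_cont {P : Type*} [TopologicalSpace P] {a : ℕ → P → ℝ} (ha : ∀ i, Continuous (a i)) :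
    ∀ i, ∀ s : ℝ → ℝ, ContDiff ℝ (⊤ : ℕ∞) s →
      Continuous (fun t => PowerSeries.coeff i (Qs s (fun i => a i t))) := by
  intro i
  simp only [Qs, PowerSeries.coeff_mk]
  induction i using Nat.strong_induction_on with
  | _ i ih =>
  intro s hs
  have hs' : ContDiff ℝ (⊤ : ℕ∞) (deriv s) := (contDiff_infty_iff_deriv.1 hs).2
  cases i with
  | zero => simp only [qc]; exact hs.continuous.comp (ha 0)
  | succ i =>
    simp only [qc]
    refine Continuous.div_const (continuous_finsetSum _ fun k _ => ?_) _
    exact (ih k k.2 _ hs').mul ((ha _).mul_const _)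

lemma Qs_smooth {a : ℕ → ℝ → ℝ} (ha : ∀ i, ContDiff ℝ (⊤ : ℕ∞) (a i)) :
    ∀ i, ∀ s : ℝ → ℝ, ContDiff ℝ (⊤ : ℕ∞) s →
      ContDiff ℝ (⊤ : ℕ∞) (fun t => PowerSeries.coeff i (Qs s (fun i => a i t))) := by
  intro i
  simp only [Qs, PowerSeries.coeff_mk]
  induction i using Nat.strong_induction_on with
  | _ i ih =>
  intro s hs
  have hs' : ContDiff ℝ (⊤ : ℕ∞) (deriv s) := (contDiff_infty_iff_deriv.1 hs).2
  cases i with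
  | zero => simp only [qc]; exact hs.comp (ha 0)
  | succ i =>
    simp only [qc]
    refine ContDiff.div_const (ContDiff.sum fun k _ => ?_) _
    exact (ih k k.2 _ hs').mul ((ha _).mul contDiff_const)

/-- `qc` at a constant series. -/
lemma qc_zero (i : ℕ) (s : ℝ → ℝ) (S : ℕ → ℝ) (hS : ∀ i, 1 ≤ i → S i = 0) :
    qc i s S = if i = 0 then s (S 0) else 0 := by
  cases i with
  | zero => simp [qc]
  | succ i =>
    simp only [qc]
    rw [Finset.sum_eq_zero]
    · simp
    · intro k _
      rw [hS _ (by omega)]; simp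

lemma qc_per (s : ℝ → ℝ) (hs : ∀ t, s (t + 1) = s t) (S S' : ℕ → ℝ) (h0 : S' 0 = S 0 + 1)
    (h : ∀ i, 1 ≤ i → S' i = S i) (i : ℕ) : qc i s S' = qc i s S := by
  induction i using Nat.strong_induction_on generalizing s with
  | _ i ih =>
  cases i with
  | zero => simp [qc, h0, hs]
  | succ i =>
    simp only [qc]
    congr 1
    refine Finset.sum_congr rfl fun k _ => ?_
    rw [ih k k.2 (deriv s), h _ (by omega)]
    intro t
    rw [← deriv_comp_add_const, funext hs]

/-- the approximating series -/
noncomputable def Zs (r : ℕ) (s : ℕ → ℝ → ℝ) (x : ℝ) (S : ℕ → ℝ) : PowerSeries ℝ :=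
  ∑ k ∈ Finset.range (r + 1), Qs (s k) S *
    ((PowerSeries.C x + PowerSeries.X - PowerSeries.mk S) ^ k * PowerSeries.C (1 / (k.factorial : ℝ)))

lemma Zs_chain {x : ℝ → ℝ} (hx : Differentiable ℝ x) {a : ℕ → ℝ → ℝ} {r : ℕ}
    (ha : ∀ i < r, ChainAt (deriv x) (fun t => PowerSeries.mk fun i => a i t) i)
    (s : ℕ → ℝ → ℝ) (hs : ∀ k, ContDiff ℝ (⊤ : ℕ∞) (s k)) :
    ∀ i < r, ChainAt (deriv x) (fun t => Zs r s (x t) (fun i => a i t)) i := by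
  intro i hi
  refine ChainAt.sum fun k _ => ChainAt.mul (fun j hj => Qs_chain ha j (by omega) _ (hs k)) ?_
  intro j hj
  refine ChainAt.mul (fun l hl => ?_) (fun l _ => ChainAt.const)
  refine ChainAt.pow (i := i) (fun m hm => ?_) k l (by omega)
  refine ChainAt.sub ?_ (ha m (by omega))
  intro t
  have : HasDerivAt (fun t => PowerSeries.coeff m (PowerSeries.C (x t) + PowerSeries.X))
      (if m = 0 then deriv x t else 0) t := by
    by_cases hm0 : m = 0
    · subst hm0
      simpa using (hx t).hasDerivAt
    · simp only [map_add, PowerSeries.coeff_C, if_neg hm0]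
      exact hasDerivAt_const _ _
  refine this.congr_deriv ?_
  simp [PowerSeries.coeff_one]

/-- A predicate on real functions closed under algebra, giving coefficientwise closure. -/
lemma coeff_closed {P : Type*} (R : (P → ℝ) → Prop) (hadd : ∀ f g, R f → R g → R (fun p => f p + g p))
    (hmul : ∀ f g, R f → R g → R (fun p => f p * g p)) (hc : ∀ c : ℝ, R (fun _ => c))
    {r : ℕ} {s : ℕ → ℝ → ℝ} {x : P → ℝ} {a : ℕ → P → ℝ} (hx : R x) (ha : ∀ i, R (a i))
    (hq : ∀ i k, R (fun p => PowerSeries.coeff i (Qs (s k) (fun i => a i p)))) (i : ℕ) :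
    R (fun p => PowerSeries.coeff i (Zs r s (x p) (fun i => a i p))) := by
  have hsum : ∀ {ι : Type} (A : Finset ι) (f : ι → P → ℝ), (∀ k ∈ A, R (f k)) →
      R (fun p => ∑ k ∈ A, f k p) := by
    intro ι A f
    classical
    induction A using Finset.induction_on with
    | empty => intro _; simpa using hc 0
    | insert b A hb ih =>
      intro h
      simp only [Finset.sum_insert hb]
      exact hadd _ _ (h b (by simp)) (ih fun k hk => h k (by simp [hk]))
  have hpm : ∀ f g : P → PowerSeries ℝ, (∀ i, R (fun p => PowerSeries.coeff i (f p))) →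
      (∀ i, R (fun p => PowerSeries.coeff i (g p))) →
      ∀ i, R (fun p => PowerSeries.coeff i (f p * g p)) := by
    intro f g hf hg i
    simp only [PowerSeries.coeff_mul]
    exact hsum _ _ fun k _ => hmul _ _ (hf _) (hg _)
  have hY : ∀ i, R (fun p => PowerSeries.coeff i
      (PowerSeries.C (x p) + PowerSeries.X - PowerSeries.mk fun i => a i p)) := by
    intro i
    have h1 : R (fun p => PowerSeries.coeff i (PowerSeries.C (x p) : PowerSeries ℝ)) := by
      by_cases h : i = 0
      · simpa [PowerSeries.coeff_C, h] using hx
      · simpa [PowerSeries.coeff_C, h] using hc 0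
    have h2 := hadd _ _ (hadd _ _ h1 (hc (PowerSeries.coeff i (PowerSeries.X : PowerSeries ℝ))))
      (hmul _ _ (hc (-1)) (ha i))
    simpa [sub_eq_add_neg] using h2
  have hYk : ∀ k i, R (fun p => PowerSeries.coeff i
      ((PowerSeries.C (x p) + PowerSeries.X - PowerSeries.mk fun i => a i p) ^ k)) := by
    intro k
    induction k with
    | zero => intro i; simpa using hc (PowerSeries.coeff i (1 : PowerSeries ℝ))
    | succ k ih => intro i; simp only [pow_succ]; exact hpm _ _ ih hY i
  simp only [Zs, map_sum]
  refine hsum _ _ fun k _ => ?_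
  refine hpm _ _ (fun i => hq i k) (hpm _ _ (hYk k) fun i => hc _) i

lemma Zs_diag (r : ℕ) (s : ℕ → ℝ → ℝ) (t : ℝ) (S : ℕ → ℝ) (h0 : S 0 = t)
    (hS : ∀ i, 1 ≤ i → S i = 0) (i : ℕ) (hi : i ≤ r) :
    (i.factorial : ℝ) * PowerSeries.coeff i (Zs r s t S) = s i t := by
  have h1 : (PowerSeries.C t + PowerSeries.X - PowerSeries.mk S : PowerSeries ℝ) = PowerSeries.X := by
    ext j
    by_cases hj : j = 0
    · subst hj; simp [h0]
    · simp [PowerSeries.coeff_C, hj, hS j (by omega)]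
  have h2 : ∀ k, Qs (s k) S = PowerSeries.C (s k t) := by
    intro k; ext j
    simp [Qs, qc_zero _ _ _ hS, PowerSeries.coeff_C, h0]
  simp only [Zs, h1, h2, map_sum, PowerSeries.coeff_C_mul, PowerSeries.coeff_mul_C,
    PowerSeries.coeff_X_pow]
  rw [Finset.sum_eq_single i]
  · have : (i.factorial : ℝ) ≠ 0 := by positivity
    simp; field_simp
  · intro b _ hb; simp [Ne.symm hb]
  · intro h; simp at h; omega

lemma Zs_zero (r : ℕ) (s : ℕ → ℝ → ℝ) (x : ℝ) (S : ℕ → ℝ) :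
    PowerSeries.coeff 0 (Zs r s x S) =
      ∑ k ∈ Finset.range (r + 1), s k (S 0) * ((x - S 0) ^ k * (1 / (k.factorial : ℝ))) := by
  have h1 : PowerSeries.constantCoeff (PowerSeries.mk S) = S 0 := by
    rw [← PowerSeries.coeff_zero_eq_constantCoeff_apply, PowerSeries.coeff_mk]
  have h2 : ∀ k, PowerSeries.constantCoeff (Qs (s k) S) = s k (S 0) := by
    intro k
    rw [← PowerSeries.coeff_zero_eq_constantCoeff_apply, Qs, PowerSeries.coeff_mk, qc]
  simp [Zs, h1, h2]

lemma Zs_per (r : ℕ) (s : ℕ → ℝ → ℝ) (hs : ∀ k t, s k (t + 1) = s k t) (x : ℝ) (S S' : ℕ → ℝ)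
    (h0 : S' 0 = S 0 + 1) (h : ∀ i, 1 ≤ i → S' i = S i) : Zs r s (x + 1) S' = Zs r s x S := by
  have h1 : (PowerSeries.C (x + 1) + PowerSeries.X - PowerSeries.mk S' : PowerSeries ℝ) =
    PowerSeries.C x + PowerSeries.X - PowerSeries.mk S := by
    ext j
    by_cases hj : j = 0
    · subst hj; simp [h0]
    · simp [PowerSeries.coeff_C, hj, h j (by omega)]
  have h2 : ∀ k, Qs (s k) S' = Qs (s k) S := by
    intro k; ext j
    simp [Qs, qc_per _ (hs k) S S' h0 h]
  simp only [Zs, h1, h2]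

lemma bounded_of_per (s : ℝ → ℝ) (hs : Continuous s) (hp : ∀ t, s (t + 1) = s t) :
    ∃ K, 0 ≤ K ∧ ∀ t, |s t| ≤ K := by
  have hper : Function.Periodic s 1 := hp
  obtain ⟨K, hK⟩ := (isCompact_Icc (a := (0 : ℝ)) (b := 1)).exists_bound_of_continuousOn hs.continuousOn
  refine ⟨max K 0, le_max_right _ _, fun t => ?_⟩
  have h1 : s t = s (Int.fract t) := by
    have := hper.sub_int_mul_eq (x := t) ⌊t⌋
    rw [← this]; simp
  rw [h1]
  exact (hK _ ⟨Int.fract_nonneg t, (Int.fract_lt_one t).le⟩).trans (le_max_left _ _)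

lemma lip_one (s : ℝ → ℝ) (hs : ContDiff ℝ (⊤ : ℕ∞) s) (hp : ∀ t, s (t + 1) = s t) (k : ℕ) :
    ∃ B, ∀ x y y' : ℝ, |x - y| ≤ 1 → |x - y'| ≤ 1 →
      |s y * ((x - y) ^ k * (1 / (k.factorial : ℝ))) - s y' * ((x - y') ^ k * (1 / (k.factorial : ℝ)))|
        ≤ B * |y - y'| := by
  obtain ⟨K, hK0, hK⟩ := bounded_of_per s hs.continuous hp
  have hs' := (contDiff_infty_iff_deriv.1 hs)
  obtain ⟨L, hL0, hL⟩ := bounded_of_per (deriv s) hs'.2.continuous (by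
    intro t
    rw [← deriv_comp_add_const, funext hp])
  refine ⟨K * k + L, fun x y y' hy hy' => ?_⟩
  have hlip : |s y - s y'| ≤ L * |y - y'| := by
    have := Convex.norm_image_sub_le_of_norm_deriv_le (𝕜 := ℝ) (f := s) (s := Set.univ) (C := L)
      (x := y') (y := y) (fun x _ => hs'.1 x) (fun x _ => hL x) convex_univ trivial trivial
    simpa using this
  have hpow : |(x - y) ^ k - (x - y') ^ k| ≤ k * |y - y'| := by
    have h := abs_pow_sub_pow_le (x - y) (x - y') k
    have h1 : max |x - y| |x - y'| ^ (k - 1) ≤ 1 :=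
      pow_le_one₀ (le_max_of_le_left (abs_nonneg _)) (max_le hy hy')
    have h2 : |x - y - (x - y')| = |y - y'| := by rw [← abs_neg]; ring_nf
    rw [h2] at h
    calc _ ≤ _ := h
      _ ≤ |y - y'| * k * 1 := by gcongr
      _ = _ := by ring
  have hfac : (1 / (k.factorial : ℝ)) ≤ 1 := by
    rw [div_le_one (by positivity)]
    exact_mod_cast Nat.one_le_iff_ne_zero.2 k.factorial_ne_zero
  have hfac0 : 0 ≤ (1 / (k.factorial : ℝ)) := by positivity
  have hp1 : |(x - y') ^ k| ≤ 1 := by rw [abs_pow]; exact pow_le_one₀ (abs_nonneg _) hy'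
  have e : s y * ((x - y) ^ k * (1 / (k.factorial : ℝ))) - s y' * ((x - y') ^ k * (1 / (k.factorial : ℝ)))
    = (s y * ((x - y) ^ k - (x - y') ^ k) + (s y - s y') * (x - y') ^ k) * (1 / (k.factorial : ℝ)) := by
    ring
  rw [e, abs_mul, abs_of_nonneg hfac0]
  calc _ ≤ |s y * ((x - y) ^ k - (x - y') ^ k) + (s y - s y') * (x - y') ^ k| * 1 := by gcongr
    _ ≤ |s y| * |(x - y) ^ k - (x - y') ^ k| + |s y - s y'| * |(x - y') ^ k| := by
      rw [mul_one, ← abs_mul, ← abs_mul]; exact abs_add_le _ _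
    _ ≤ K * (k * |y - y'|) + (L * |y - y'|) * 1 := by
      gcongr
      exact hK y
    _ = _ := by ring

lemma lip_F (r : ℕ) (s : ℕ → ℝ → ℝ) (hs : ∀ k, ContDiff ℝ (⊤ : ℕ∞) (s k))
    (hp : ∀ k t, s k (t + 1) = s k t) :
    ∃ B, 0 ≤ B ∧ ∀ x y y' : ℝ, |x - y| ≤ 1 → |x - y'| ≤ 1 →
      |(∑ k ∈ Finset.range (r + 1), s k y * ((x - y) ^ k * (1 / (k.factorial : ℝ)))) -
       (∑ k ∈ Finset.range (r + 1), s k y' * ((x - y') ^ k * (1 / (k.factorial : ℝ))))|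
        ≤ B * |y - y'| := by
  choose B hB using fun k => lip_one (s k) (hs k) (hp k) k
  refine ⟨∑ k ∈ Finset.range (r + 1), |B k|, by positivity, fun x y y' hy hy' => ?_⟩
  rw [← Finset.sum_sub_distrib, Finset.sum_mul]
  refine (Finset.abs_sum_le_sum_abs _ _).trans (Finset.sum_le_sum fun k _ => ?_)
  refine (hB k x y y' hy hy').trans ?_
  gcongr
  exact le_abs_self _

lemma scalar_approx (r : ℕ) (s : ℕ → ℝ → ℝ) (hs : ∀ k, ContDiff ℝ (⊤ : ℕ∞) (s k))
    (hp : ∀ k t, s k (t + 1) = s k t) (ε : ℝ) (hε : 0 < ε) :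
    ∃ δ > 0, ∀ (x : ℝ → ℝ) (S : ℕ → ℝ → ℝ), ContDiff ℝ (⊤ : ℕ∞) x →
      (∀ i, ContDiff ℝ (⊤ : ℕ∞) (S i)) → (∀ t, x (t + 1) = x t + 1) → (∀ t, S 0 (t + 1) = S 0 t + 1) →
      (∀ i, 1 ≤ i → ∀ t, S i (t + 1) = S i t) →
      (∀ i < r, ∀ t, deriv (S i) t = deriv x t * S (i + 1) t) →
      (∀ t, |x t - t| < δ) → (∀ t, |S 0 t - t| < δ) → (∀ i, 1 ≤ i → ∀ t, |S i t| < δ) →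
      (∀ i, r < i → ∀ t, S i t = 0) →
      ∃ z : ℕ → ℝ → ℝ, (∀ i, ContDiff ℝ (⊤ : ℕ∞) (z i)) ∧ (∀ i t, z i (t + 1) = z i t) ∧
        (∀ i < r, ∀ t, deriv (z i) t = deriv x t * z (i + 1) t) ∧
        (∀ i ≤ r, ∀ t, |z i t - s i t| < ε) ∧
        (∀ t, z 0 t = ∑ k ∈ Finset.range (r + 1),
          s k (S 0 t) * ((x t - S 0 t) ^ k * (1 / (k.factorial : ℝ)))) := by
  -- the parameter space
  let Pt := ℝ × ℝ × (Fin (r + 1) → ℝ)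
  let em : ℕ → Pt → ℝ := fun i p => if h : i < r + 1 then p.2.2 ⟨i, h⟩ else 0
  have hem : ∀ i, Continuous (em i) := by
    intro i
    by_cases h : i < r + 1
    · simp only [em, h, dif_pos]; fun_prop
    · simp only [em, h, dif_neg, not_false_eq_true]; fun_prop
  let Ψ : ℕ → Pt → ℝ := fun i p => (i.factorial : ℝ) *
    PowerSeries.coeff i (Zs r s p.2.1 (fun j => em j p)) - s i p.1
  have hΨ : ∀ i, Continuous (Ψ i) := by
    intro i
    refine Continuous.sub (continuous_const.mul ?_) ((hs i).continuous.comp continuous_fst)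
    refine coeff_closed (P := Pt) (R := Continuous) (fun f g hf hg => hf.add hg)
      (fun f g hf hg => hf.mul hg) (fun c => continuous_const) (x := fun p => p.2.1)
      (by fun_prop) hem (fun i k => Qs_cont hem i _ (hs k)) i
  let cur : ℝ → Pt := fun t => (t, t, fun j => if j = 0 then t else 0)
  have hcur : Continuous cur := by
    refine continuous_id.prodMk (continuous_id.prodMk (continuous_pi fun j => ?_))
    by_cases h : j = 0
    · simp only [h, if_true]; exact continuous_id
    · simp only [h, if_false]; exact continuous_const
  have hzero : ∀ i ≤ r, ∀ t, Ψ i (cur t) = 0 := by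
    intro i hi t
    simp only [Ψ]
    rw [sub_eq_zero]
    refine Zs_diag r s t _ ?_ ?_ i hi
    · simp [em, cur]
    · intro j hj
      simp only [em, cur]
      split_ifs with h1 h2
      · rw [Fin.ext_iff] at h2; simp at h2; omega
      · rfl
      · rfl
  have hK : IsCompact (cur '' Set.Icc 0 1) := isCompact_Icc.image hcur
  have hU : IsOpen {p : Pt | ∀ i ∈ Finset.range (r + 1), |Ψ i p| < ε} := by
    have : {p : Pt | ∀ i ∈ Finset.range (r + 1), |Ψ i p| < ε} =
        ⋂ i ∈ Finset.range (r + 1), {p : Pt | |Ψ i p| < ε} := by ext p; simp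
    rw [this]
    exact isOpen_biInter_finset fun i _ => isOpen_lt (hΨ i).abs continuous_const
  obtain ⟨δ, hδ, hsub⟩ := hK.exists_thickening_subset_open hU (by
    rintro _ ⟨t, _, rfl⟩ i hi
    rw [hzero i (by simp at hi; omega) t]; simpa using hε)
  refine ⟨δ, hδ, ?_⟩
  intro x S hx hS hxp hS0 hSp hch hxδ hS0δ hSδ hSr
  let a : ℕ → ℝ → ℝ := fun i t => S i t / (i.factorial : ℝ)
  have ha : ∀ i, ContDiff ℝ (⊤ : ℕ∞) (a i) := fun i => (hS i).div_const _
  have hchain : ∀ i < r, ChainAt (deriv x) (fun t => PowerSeries.mk fun i => a i t) i := by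
    intro i hi t
    have h1 := (((hS i).differentiable (by simp)) t).hasDerivAt.div_const (i.factorial : ℝ)
    simp only [PowerSeries.coeff_mk, PowerSeries.coeff_derivative]
    refine h1.congr_deriv ?_
    rw [hch i hi t]
    simp only [a, Nat.factorial_succ]
    have : (i.factorial : ℝ) ≠ 0 := by positivity
    have h3 : (i : ℝ) + 1 ≠ 0 := by positivity
    push_cast
    field_simp
  have ha0 : ∀ t, a 0 (t + 1) = a 0 t + 1 := by intro t; simp [a, hS0]
  have hap : ∀ i, 1 ≤ i → ∀ t, a i (t + 1) = a i t := by intro i hi t; simp [a, hSp i hi]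
  have haδ : ∀ i, 1 ≤ i → ∀ t, |a i t| < δ := by
    intro i hi t
    refine lt_of_le_of_lt ?_ (hSδ i hi t)
    simp only [a, abs_div]
    refine div_le_self (abs_nonneg _) ?_
    rw [Nat.abs_cast]
    exact_mod_cast Nat.one_le_iff_ne_zero.2 i.factorial_ne_zero
  have hzper : ∀ i t, (i.factorial : ℝ) * PowerSeries.coeff i (Zs r s (x (t + 1)) (fun j => a j (t + 1)))
      = (i.factorial : ℝ) * PowerSeries.coeff i (Zs r s (x t) (fun j => a j t)) := by
    intro i t
    rw [hxp, Zs_per r s hp (x t) (fun j => a j t) (fun j => a j (t + 1)) (ha0 t) (fun j hj => hap j hj t)]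
  have hsm : ∀ i, ContDiff ℝ (⊤ : ℕ∞) (fun t => PowerSeries.coeff i (Zs r s (x t) (fun j => a j t))) :=
    fun i => coeff_closed (P := ℝ) (R := ContDiff ℝ (⊤ : ℕ∞)) (fun f g hf hg => hf.add hg)
      (fun f g hf hg => hf.mul hg) (fun c => contDiff_const) hx ha
      (fun i k => Qs_smooth ha i _ (hs k)) i
  refine ⟨fun i t => (i.factorial : ℝ) * PowerSeries.coeff i (Zs r s (x t) (fun j => a j t)),
    fun i => contDiff_const.mul (hsm i), hzper, ?_, ?_, ?_⟩
  · intro i hi t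
    have h := (Zs_chain (hx.differentiable (by simp)) hchain s hs i hi t).const_mul (i.factorial : ℝ)
    rw [h.deriv, PowerSeries.coeff_derivative]
    simp only [Nat.factorial_succ]
    push_cast
    ring
  · intro i hi t
    have key : ∀ t ∈ Set.Icc (0 : ℝ) 1, |(i.factorial : ℝ) *
        PowerSeries.coeff i (Zs r s (x t) (fun j => a j t)) - s i t| < ε := by
      intro t ht
      have hmem : ((t, x t, fun j => a j t) : Pt) ∈ Metric.thickening δ (cur '' Set.Icc 0 1) := by
        rw [Metric.mem_thickening_iff]
        refine ⟨cur t, ⟨t, ht, rfl⟩, ?_⟩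
        rw [Prod.dist_eq, Prod.dist_eq]
        refine max_lt (by simpa [cur] using hδ) (max_lt (by simpa [Real.dist_eq, cur] using hxδ t) ?_)
        rw [dist_pi_lt_iff hδ]
        intro j
        simp only [cur, Real.dist_eq]
        by_cases hj : j = 0
        · subst hj; simpa [a] using hS0δ t
        · simp only [hj, if_false, sub_zero]
          refine haδ j ?_ t
          rcases Nat.eq_zero_or_pos j with h | h
          · exact absurd (Fin.ext h) hj
          · exact h
      have h := hsub hmem i (by simp; omega)
      have e : (fun j => em j (t, x t, fun j => a j t)) = fun j => a j t := by
        funext j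
        simp only [em]
        split_ifs with hj
        · rfl
        · simp [a, hSr j (by omega)]
      simpa only [Ψ, e] using h
    have hper : Function.Periodic (fun t => (i.factorial : ℝ) *
        PowerSeries.coeff i (Zs r s (x t) (fun j => a j t)) - s i t) 1 := by
      intro t; simp only [hzper, hp]
    have h2 := hper.sub_int_mul_eq (x := t) ⌊t⌋
    have h3 := key (Int.fract t) ⟨Int.fract_nonneg t, (Int.fract_lt_one t).le⟩
    simp only [mul_one] at h2
    simp only at h2 ⊢
    rw [← h2]
    exact h3
  · intro t
    simp only [Nat.factorial_zero, Nat.cast_one, one_mul]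
    rw [Zs_zero]
    simp [a]


/-- Families of trigonometric polynomials, bounded uniformly in the parameter. -/
inductive TP : (ℕ → ℝ → ℝ) → Prop
  | const (c : ℝ) : TP (fun _ _ => c)
  | inv : TP (fun M _ => 1 / (M : ℝ))
  | s1 : TP (fun M τ => Real.sin (τ / (2 * M)))
  | c1 : TP (fun M τ => Real.cos (τ / (2 * M)))
  | s2 : TP (fun _ τ => Real.sin τ)
  | c2 : TP (fun _ τ => Real.cos τ)
  | add {f g} : TP f → TP g → TP (fun M τ => f M τ + g M τ)
  | mul {f g} : TP f → TP g → TP (fun M τ => f M τ * g M τ)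

lemma TP.analytic {f : ℕ → ℝ → ℝ} (hf : TP f) (M : ℕ) : AnalyticOnNhd ℝ (f M) Set.univ := by
  induction hf with
  | const c => exact analyticOnNhd_const
  | inv => exact analyticOnNhd_const
  | s1 =>
    intro x _
    exact Real.analyticAt_sin.comp ((analyticAt_id).div_const)
  | c1 =>
    intro x _
    exact Real.analyticAt_cos.comp ((analyticAt_id).div_const)
  | s2 => intro x _; exact Real.analyticAt_sin
  | c2 => intro x _; exact Real.analyticAt_cos
  | add _ _ h1 h2 => intro x hx; exact (h1 x hx).add (h2 x hx)
  | mul _ _ h1 h2 => intro x hx; exact (h1 x hx).mul (h2 x hx)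

lemma TP.smooth {f : ℕ → ℝ → ℝ} (hf : TP f) (M : ℕ) : ContDiff ℝ (⊤ : ℕ∞) (f M) :=
  (hf.analytic M).contDiff

lemma TP.bdd {f : ℕ → ℝ → ℝ} (hf : TP f) : ∃ K, 0 ≤ K ∧ ∀ M τ, |f M τ| ≤ K := by
  induction hf with
  | const c => exact ⟨|c|, abs_nonneg _, fun _ _ => le_rfl⟩
  | inv =>
    refine ⟨1, zero_le_one, fun M _ => ?_⟩
    rw [abs_of_nonneg (by positivity)]
    rcases Nat.eq_zero_or_pos M with h | h
    · simp [h]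
    · rw [div_le_one (by exact_mod_cast h)]; exact_mod_cast h
  | s1 => exact ⟨1, zero_le_one, fun M τ => Real.abs_sin_le_one _⟩
  | c1 => exact ⟨1, zero_le_one, fun M τ => Real.abs_cos_le_one _⟩
  | s2 => exact ⟨1, zero_le_one, fun M τ => Real.abs_sin_le_one _⟩
  | c2 => exact ⟨1, zero_le_one, fun M τ => Real.abs_cos_le_one _⟩
  | add _ _ h1 h2 =>
    obtain ⟨K, hK, h1⟩ := h1
    obtain ⟨L, hL, h2⟩ := h2
    exact ⟨K + L, by positivity, fun M τ => (abs_add_le _ _).trans (add_le_add (h1 _ _) (h2 _ _))⟩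
  | mul _ _ h1 h2 =>
    obtain ⟨K, hK, h1⟩ := h1
    obtain ⟨L, hL, h2⟩ := h2
    refine ⟨K * L, by positivity, fun M τ => ?_⟩
    rw [abs_mul]
    exact mul_le_mul (h1 _ _) (h2 _ _) (abs_nonneg _) hK

lemma TP.per {f : ℕ → ℝ → ℝ} (hf : TP f) (M : ℕ) (hM : 1 ≤ M) (τ : ℝ) :
    f M (τ + 4 * Real.pi * M) = f M τ := by
  have hM' : (M : ℝ) ≠ 0 := by positivity
  have e1 : (τ + 4 * Real.pi * M) / (2 * M) = τ / (2 * M) + 2 * Real.pi := by field_simp; ring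
  have e2 : τ + 4 * Real.pi * M = τ + (2 * M : ℕ) * (2 * Real.pi) := by push_cast; ring
  induction hf with
  | const c => rfl
  | inv => rfl
  | s1 => simp only [e1, Real.sin_add_two_pi]
  | c1 => simp only [e1, Real.cos_add_two_pi]
  | s2 => simp only [e2, Real.sin_add_nat_mul_two_pi]
  | c2 => simp only [e2, Real.cos_add_nat_mul_two_pi]
  | add _ _ h1 h2 => simp only [h1, h2]
  | mul _ _ h1 h2 => simp only [h1, h2]

lemma TP.hasDeriv {f : ℕ → ℝ → ℝ} (hf : TP f) :
    ∃ g, TP g ∧ ∀ M τ, HasDerivAt (f M) (g M τ) τ := by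
  have hl : ∀ (M : ℕ) (τ : ℝ), HasDerivAt (fun τ : ℝ => τ / (2 * M)) (1 / 2 * (1 / (M : ℝ))) τ := by
    intro M τ
    refine ((hasDerivAt_id τ).div_const (2 * (M : ℝ))).congr_deriv ?_
    rw [one_div_mul_one_div]
  induction hf with
  | const c => exact ⟨_, TP.const 0, fun _ τ => hasDerivAt_const τ c⟩
  | inv => exact ⟨_, TP.const 0, fun _ τ => hasDerivAt_const τ _⟩
  | s1 => exact ⟨_, TP.c1.mul ((TP.const (1 / 2)).mul TP.inv), fun M τ => (hl M τ).sin⟩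
  | c1 =>
    refine ⟨_, (TP.const (-1)).mul (TP.s1.mul ((TP.const (1 / 2)).mul TP.inv)), fun M τ => ?_⟩
    refine (hl M τ).cos.congr_deriv ?_
    ring
  | s2 => exact ⟨_, TP.c2, fun _ τ => Real.hasDerivAt_sin τ⟩
  | c2 =>
    refine ⟨_, (TP.const (-1)).mul TP.s2, fun M τ => ?_⟩
    exact (Real.hasDerivAt_cos τ).congr_deriv (by ring)
  | add _ _ h1 h2 =>
    obtain ⟨f', hf', h1⟩ := h1
    obtain ⟨g', hg', h2⟩ := h2
    exact ⟨_, hf'.add hg', fun M τ => (h1 M τ).add (h2 M τ)⟩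
  | @mul f g hf hg h1 h2 =>
    obtain ⟨f', hf', h1⟩ := h1
    obtain ⟨g', hg', h2⟩ := h2
    exact ⟨_, (hf'.mul hg).add (hf.mul hg'), fun M τ => (h1 M τ).mul (h2 M τ)⟩

lemma TP.pow {f : ℕ → ℝ → ℝ} (hf : TP f) (k : ℕ) : TP (fun M τ => f M τ ^ k) := by
  induction k with
  | zero => simpa using TP.const 1
  | succ k ih => simp only [pow_succ]; exact ih.mul hf

/-- the zigzag -/
noncomputable def Xz (M : ℕ) (τ : ℝ) : ℝ :=
  τ / (2 * Real.pi * M) + 1 / 4 * (Real.sin (τ / (2 * M)) ^ 2 * Real.sin τ)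

/-- its derivative -/
noncomputable def Xd (M : ℕ) (τ : ℝ) : ℝ :=
  1 / (2 * Real.pi) * (1 / (M : ℝ)) + 1 / 4 *
    ((1 / (M : ℝ)) * (Real.sin (τ / (2 * M)) * (Real.cos (τ / (2 * M)) * Real.sin τ)) +
      Real.sin (τ / (2 * M)) ^ 2 * Real.cos τ)

lemma Xd_TP : TP Xd :=
  ((TP.const _).mul TP.inv).add ((TP.const _).mul
    ((TP.inv.mul (TP.s1.mul (TP.c1.mul TP.s2))).add ((TP.s1.pow 2).mul TP.c2)))

lemma Xz_deriv (M : ℕ) (τ : ℝ) : HasDerivAt (Xz M) (Xd M τ) τ := by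
  have hl : HasDerivAt (fun τ : ℝ => τ / (2 * M)) (1 / 2 * (1 / (M : ℝ))) τ := by
    refine ((hasDerivAt_id τ).div_const (2 * (M : ℝ))).congr_deriv ?_
    rw [one_div_mul_one_div]
  have h := ((hasDerivAt_id τ).div_const (2 * Real.pi * M)).add
    (((hl.sin.pow 2).mul (Real.hasDerivAt_sin τ)).const_mul (1 / 4))
  refine h.congr_deriv ?_
  simp only [Xd, Pi.pow_apply]
  rw [← one_div_mul_one_div]
  push_cast
  ring

lemma tower (r : ℕ) (e : ℕ → ℝ → ℝ) (he : TP e) :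
    ∃ E : ℕ → ℕ → ℝ → ℝ, (∀ i, TP (E i)) ∧ (∀ M τ, E 1 M τ = e M τ * Xd M τ ^ (2 * r - 1)) ∧
      ∀ i, 1 ≤ i → i < r → ∀ M τ, HasDerivAt (E i M) (Xd M τ * E (i + 1) M τ) τ := by
  obtain ⟨Xdd, hXdd, hX2⟩ := Xd_TP.hasDeriv
  have hd : ∀ f : {f // TP f}, ∃ g : {g // TP g}, ∀ M τ, HasDerivAt (f.1 M) (g.1 M τ) τ := by
    rintro ⟨f, hf⟩
    obtain ⟨g, hg, h⟩ := hf.hasDeriv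
    exact ⟨⟨g, hg⟩, h⟩
  choose D hD using hd
  let gg : ℕ → {f // TP f} := fun k => Nat.rec ⟨e, he⟩ (fun k g =>
    ⟨_, ((TP.const (2 * r - 1 - 2 * k : ℕ)).mul (hXdd.mul g.2)).add (Xd_TP.mul (D g).2)⟩) k
  have hgg : ∀ k M τ, (gg (k + 1)).1 M τ = ((2 * r - 1 - 2 * k : ℕ) : ℝ) * (Xdd M τ * (gg k).1 M τ)
    + Xd M τ * (D (gg k)).1 M τ := fun k M τ => rfl
  refine ⟨fun i M τ => (gg (i - 1)).1 M τ * Xd M τ ^ (2 * r - 1 - 2 * (i - 1)),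
    fun i => (gg (i - 1)).2.mul (Xd_TP.pow _), fun M τ => rfl, ?_⟩
  intro i hi hir M τ
  obtain ⟨k, rfl⟩ : ∃ k, i = k + 1 := ⟨i - 1, by omega⟩
  obtain ⟨p, hp⟩ : ∃ p, 2 * r - 1 - 2 * k = p + 2 := ⟨2 * r - 1 - 2 * k - 2, by omega⟩
  have hp' : 2 * r - 1 - 2 * (k + 1) = p := by omega
  have h := (hD (gg k) M τ).mul ((hX2 M τ).pow (p + 2))
  simp only [Nat.add_sub_cancel, hp, hp']
  refine h.congr_deriv ?_
  rw [hgg, hp]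
  simp only [Pi.pow_apply]
  push_cast
  ring_nf

lemma int_cos_mul (a p : ℝ) (ha : a ≠ 0) (h : Real.sin (a * p) = 0) :
    ∫ τ in (0 : ℝ)..p, Real.cos (a * τ) = 0 := by
  rw [intervalIntegral.integral_comp_mul_left (fun x => Real.cos x) ha]
  simp [h]

set_option maxHeartbeats 1000000 in
lemma int_lower (r : ℕ) (hr : 1 ≤ r) : ∃ c > 0, ∀ M : ℕ, 128 ≤ M →
    c * M ≤ ∫ τ in (0 : ℝ)..(4 * Real.pi * M), Real.sin (τ / (2 * M)) ^ 2 * Xd M τ ^ (2 * r) := by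
  set b : ℝ := 1 / 64 with hb
  set q : ℝ := 2 * r * b ^ (2 * r - 1) with hq
  have hr' : (1 : ℝ) ≤ r := by exact_mod_cast hr
  have hq0 : 0 < q := by positivity
  refine ⟨q * (Real.pi / 32), by positivity, fun M hM => ?_⟩
  have hM' : (128 : ℝ) ≤ M := by exact_mod_cast hM
  have hM0 : (M : ℝ) ≠ 0 := by positivity
  have hMi : (1 : ℝ) / M ≤ 1 / 128 := one_div_le_one_div_of_le (by norm_num) hM'
  have hcont : Continuous (fun τ => Real.sin (τ / (2 * M)) ^ 2 * Xd M τ ^ (2 * r)) := by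
    have := (Xd_TP.smooth M).continuous
    fun_prop
  -- explicit lower bound
  let L : ℝ → ℝ := fun τ => q * (1 / 4 * ((1 / 8 - 1 / 4 * Real.cos ((1 / M) * τ)) +
      (1 / 8 * Real.cos (2 * τ) - 1 / 8 * Real.cos ((2 + 1 / M) * τ) - 1 / 8 * Real.cos ((2 - 1 / M) * τ)))
      - 1 / M - b)
  have hLc : Continuous L := by fun_prop
  have hle : ∀ τ, L τ ≤ Real.sin (τ / (2 * M)) ^ 2 * Xd M τ ^ (2 * r) := by
    intro τ
    set y := Xd M τ with hy
    set s := Real.sin (τ / (2 * M)) with hs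
    set c := Real.cos τ with hc
    have hb0 : 0 < b := by rw [hb]; norm_num
    have hs1 : |s| ≤ 1 := Real.abs_sin_le_one _
    have hc1 : |c| ≤ 1 := Real.abs_cos_le_one _
    have hs2 : s ^ 2 ≤ 1 := by rw [sq_le_one_iff_abs_le_one]; exact hs1
    have hc2 : c ^ 2 ≤ 1 := by rw [sq_le_one_iff_abs_le_one]; exact hc1
    -- Bernoulli
    have hB : q * (|y| - b) ≤ y ^ (2 * r) := by
      have h := one_add_mul_le_pow (a := |y| / b - 1) (by
        have : 0 ≤ |y| / b := by positivity
        linarith) (2 * r)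
      have e : (1 + (|y| / b - 1)) ^ (2 * r) = y ^ (2 * r) / b ^ (2 * r) := by
        rw [add_sub_cancel, div_pow, Even.pow_abs (even_two_mul r)]
      rw [e, le_div_iff₀ (by positivity)] at h
      refine le_trans ?_ h
      have e2 : b ^ (2 * r) = b ^ (2 * r - 1) * b := by
        rw [← pow_succ]; congr 1; omega
      rw [e2, hq]
      have hbp : 0 < b ^ (2 * r - 1) := by positivity
      have e3 : (1 + ((2 * r : ℕ) : ℝ) * (|y| / b - 1)) * (b ^ (2 * r - 1) * b) =
        b ^ (2 * r - 1) * (b + 2 * r * (|y| - b)) := by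
        push_cast
        field_simp
      rw [e3]
      nlinarith [mul_pos hbp hb0]
    have hyc : y * c ≤ |y| := by
      calc y * c ≤ |y * c| := le_abs_self _
        _ = |y| * |c| := abs_mul _ _
        _ ≤ |y| * 1 := by gcongr
        _ = |y| := mul_one _
    have h1 : s ^ 2 * (q * (y * c - b)) ≤ s ^ 2 * y ^ (2 * r) := by
      refine mul_le_mul_of_nonneg_left (le_trans ?_ hB) (sq_nonneg _)
      exact mul_le_mul_of_nonneg_left (by linarith) hq0.le
    set ρ : ℝ := 1 / (2 * Real.pi) * (1 / (M : ℝ)) + 1 / 4 *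
      ((1 / (M : ℝ)) * (s * (Real.cos (τ / (2 * M)) * Real.sin τ))) with hρ
    have hyρ : y = ρ + 1 / 4 * (s ^ 2 * c) := by rw [hy, Xd, hρ]; ring
    have hMp : 0 < 1 / (M : ℝ) := by positivity
    have hρ1 : |ρ| ≤ 1 / M := by
      have hpi : 1 / (2 * Real.pi) ≤ 1 / 2 := by
        apply one_div_le_one_div_of_le (by norm_num)
        linarith [Real.pi_gt_three]
      have hpi0 : 0 < 1 / (2 * Real.pi) := by positivity
      have h3 : |s * (Real.cos (τ / (2 * M)) * Real.sin τ)| ≤ 1 := by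
        rw [abs_mul, abs_mul]
        exact mul_le_one₀ hs1 (by positivity)
          (mul_le_one₀ (Real.abs_cos_le_one _) (abs_nonneg _) (Real.abs_sin_le_one _))
      have h4 := abs_le.1 h3
      rw [hρ, abs_le]
      constructor <;> nlinarith
    have h2 : -(1 / (M : ℝ)) ≤ s ^ 2 * c * ρ := by
      have : |s ^ 2 * c * ρ| ≤ 1 / M := by
        rw [abs_mul, abs_mul]
        calc |s ^ 2| * |c| * |ρ| ≤ 1 * 1 * (1 / M) := by
              gcongr
              rw [abs_of_nonneg (sq_nonneg _)]; exact hs2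
          _ = _ := by ring
      exact (abs_le.1 this).1
    have hL : L τ = q * (1 / 4 * ((s ^ 2 - 1 / 4) * c ^ 2) - 1 / M - b) := by
      have e1 : s ^ 2 = 1 / 2 - Real.cos ((1 / M) * τ) / 2 := by
        rw [hs, Real.sin_sq_eq_half_sub]
        congr 3
        field_simp
      have e2 : c ^ 2 = 1 / 2 + Real.cos (2 * τ) / 2 := by
        rw [hc, Real.cos_sq]
      have e3 : Real.cos ((2 + 1 / M) * τ) + Real.cos ((2 - 1 / M) * τ) =
          2 * (Real.cos (2 * τ) * Real.cos ((1 / M) * τ)) := by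
        rw [add_mul, sub_mul, Real.cos_add, Real.cos_sub]; ring
      simp only [L]
      rw [e1, e2]
      linear_combination (-1 / 32 * q) * e3
    rw [hL]
    refine le_trans ?_ h1
    rw [mul_left_comm (s ^ 2) q]
    refine mul_le_mul_of_nonneg_left ?_ hq0.le
    have e5 : s ^ 2 * (y * c - b) = s ^ 2 * c * ρ + 1 / 4 * (s ^ 4 * c ^ 2) - s ^ 2 * b := by
      rw [hyρ]; ring
    rw [e5]
    have h6 : (s ^ 2 - 1 / 4) * c ^ 2 ≤ s ^ 4 * c ^ 2 := by
      refine mul_le_mul_of_nonneg_right ?_ (sq_nonneg _)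
      nlinarith [sq_nonneg (s ^ 2 - 1 / 2)]
    have h7 : s ^ 2 * b ≤ b := mul_le_of_le_one_left hb0.le hs2
    linarith [h2, h6, h7]
  have hint : ∫ τ in (0 : ℝ)..(4 * Real.pi * M), L τ = q * ((1 / 32 - 1 / M - b) * (4 * Real.pi * M)) := by
    have hsin : ∀ k : ℤ, Real.sin (k * Real.pi) = 0 := Real.sin_int_mul_pi
    have i1 := int_cos_mul (1 / M) (4 * Real.pi * M) (by positivity) (by
      rw [show 1 / (M : ℝ) * (4 * Real.pi * M) = ((4 : ℤ) : ℝ) * Real.pi by field_simp; norm_num]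
      exact hsin _)
    have i2 := int_cos_mul 2 (4 * Real.pi * M) (by norm_num) (by
      rw [show 2 * (4 * Real.pi * M) = ((8 * M : ℤ) : ℝ) * Real.pi by push_cast; ring]
      exact hsin _)
    have i3 := int_cos_mul (2 + 1 / M) (4 * Real.pi * M) (by positivity) (by
      rw [show (2 + 1 / (M : ℝ)) * (4 * Real.pi * M) = ((8 * M + 4 : ℤ) : ℝ) * Real.pi by
        push_cast; field_simp; ring]
      exact hsin _)
    have i4 := int_cos_mul (2 - 1 / M) (4 * Real.pi * M) (by linarith) (by
      rw [show (2 - 1 / (M : ℝ)) * (4 * Real.pi * M) = ((8 * M - 4 : ℤ) : ℝ) * Real.pi by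
        push_cast; field_simp; ring]
      exact hsin _)
    have hci : ∀ a k : ℝ, IntervalIntegrable (fun τ => k * Real.cos (a * τ)) MeasureTheory.volume
        0 (4 * Real.pi * M) := by
      intro a k
      apply Continuous.intervalIntegrable
      fun_prop
    have eL : ∀ τ, L τ = q * (1 / 32 - 1 / M - b) + ((-(q / 16)) * Real.cos ((1 / M) * τ) +
        ((q / 32) * Real.cos (2 * τ) + ((-(q / 32)) * Real.cos ((2 + 1 / M) * τ) +
        (-(q / 32)) * Real.cos ((2 - 1 / M) * τ)))) := by
      intro τ; simp only [L]; ring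
    simp only [eL]
    rw [intervalIntegral.integral_add, intervalIntegral.integral_add, intervalIntegral.integral_add,
      intervalIntegral.integral_add]
    · simp only [intervalIntegral.integral_const_mul, i1, i2, i3, i4, intervalIntegral.integral_const]
      rw [smul_eq_mul]
      ring
    all_goals (apply Continuous.intervalIntegrable; fun_prop)
  calc q * (Real.pi / 32) * M ≤ q * ((1 / 32 - 1 / M - b) * (4 * Real.pi * M)) := by
        rw [mul_assoc]
        refine mul_le_mul_of_nonneg_left ?_ hq0.le
        have : (1 / 128 : ℝ) ≤ 1 / 32 - 1 / M - b := by rw [hb]; linarith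
        have h2 : 0 ≤ 4 * Real.pi * M := by positivity
        nlinarith
    _ = _ := hint.symm
    _ ≤ _ := intervalIntegral.integral_mono (by positivity) (hLc.intervalIntegrable _ _)
        (hcont.intervalIntegrable _ _) hle


lemma Xz_floor (M : ℕ) (hM : 1 ≤ M) (τ : ℝ) : ⌊Xz M τ⌋ = ⌊τ / (2 * Real.pi * M)⌋ := by
  have hM' : (0 : ℝ) < M := by exact_mod_cast hM
  set v := τ / (2 * Real.pi * M) with hv
  rw [Int.floor_eq_iff]
  set w := v - ⌊v⌋ with hw
  have hw0 : 0 ≤ w := Int.fract_nonneg v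
  have hw1 : w < 1 := Int.fract_lt_one v
  have hpi := Real.pi_pos
  have hpi4 := Real.pi_lt_four
  have e : Real.sin (τ / (2 * M)) ^ 2 = Real.sin (Real.pi * w) ^ 2 := by
    have h1 : Real.pi * w = τ / (2 * M) - ⌊v⌋ * Real.pi := by
      rw [hw, mul_sub, hv]; field_simp
    rw [h1, Real.sin_sub_int_mul_pi, mul_pow, ← zpow_natCast ((-1 : ℝ) ^ ⌊v⌋), ← zpow_mul, mul_comm ⌊v⌋, zpow_mul]
    simp
  have hs0 : 0 ≤ Real.sin (Real.pi * w) := Real.sin_nonneg_of_nonneg_of_le_pi (by positivity) (by nlinarith)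
  have hs1 : Real.sin (Real.pi * w) ≤ Real.pi * w := Real.sin_le (by positivity)
  have hs2 : Real.sin (Real.pi * w) ≤ Real.pi * (1 - w) := by
    have : Real.sin (Real.pi * w) = Real.sin (Real.pi * (1 - w)) := by
      rw [← Real.sin_pi_sub]; ring_nf
    rw [this]
    exact Real.sin_le (mul_nonneg hpi.le (by linarith))
  have hs3 : Real.sin (Real.pi * w) ≤ 1 := Real.sin_le_one _
  have hsq : Real.sin (Real.pi * w) ^ 2 ≤ Real.sin (Real.pi * w) := by nlinarith
  have hτ := abs_le.1 (Real.abs_sin_le_one τ)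
  have hX : Xz M τ = ⌊v⌋ + w + 1 / 4 * (Real.sin (Real.pi * w) ^ 2 * Real.sin τ) := by
    rw [Xz, e, hw]; ring
  have hq0 := sq_nonneg (Real.sin (Real.pi * w))
  rw [hX]
  constructor
  · nlinarith
  · nlinarith

lemma Xz_close (M : ℕ) (τ : ℝ) : |Xz M τ - τ / (2 * Real.pi * M)| ≤ 1 := by
  rw [Xz, add_sub_cancel_left, abs_mul, abs_mul, abs_pow]
  have h1 := Real.abs_sin_le_one τ
  have h2 : |Real.sin (τ / (2 * M))| ^ 2 ≤ 1 := pow_le_one₀ (abs_nonneg _) (Real.abs_sin_le_one _)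
  have h3 := mul_le_one₀ h2 (abs_nonneg _) h1
  rw [abs_of_pos (by norm_num : (0 : ℝ) < 1 / 4)]
  linarith

lemma Xz_per (M : ℕ) (hM : 1 ≤ M) (τ : ℝ) : Xz M (τ + 4 * Real.pi * M) = Xz M τ + 2 := by
  have hM' : (M : ℝ) ≠ 0 := by positivity
  have h := ((TP.s1.pow 2).mul TP.s2).per M hM τ
  rw [Xz, Xz, h]
  have := Real.pi_ne_zero
  field_simp
  ring

lemma anti_s1 (M : ℕ) (hM : 1 ≤ M) (r : ℕ) (τ : ℝ) :
    Real.sin ((τ + 2 * Real.pi * M) / (2 * M)) * Xd M (τ + 2 * Real.pi * M) ^ (2 * r) =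
      -(Real.sin (τ / (2 * M)) * Xd M τ ^ (2 * r)) := by
  have hM' : (M : ℝ) ≠ 0 := by positivity
  have e1 : (τ + 2 * Real.pi * M) / (2 * M) = τ / (2 * M) + Real.pi := by field_simp
  have e2 : τ + 2 * Real.pi * M = τ + M * (2 * Real.pi) := by ring
  have e3 : Xd M (τ + 2 * Real.pi * M) = Xd M τ := by
    rw [Xd, Xd, e1, e2, Real.sin_add_nat_mul_two_pi, Real.cos_add_nat_mul_two_pi, Real.sin_add_pi,
      Real.cos_add_pi]
    ring
  rw [e3, e1, Real.sin_add_pi]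
  ring

lemma zigzag (r : ℕ) (hr : 1 ≤ r) : ∃ K > 0, ∀ M : ℕ, 128 ≤ M →
    ∃ (X : ℝ → ℝ) (C G : ℕ → ℝ → ℝ), ContDiff ℝ (⊤ : ℕ∞) X ∧
      (∀ i, ContDiff ℝ (⊤ : ℕ∞) (C i)) ∧ (∀ i, ContDiff ℝ (⊤ : ℕ∞) (G i)) ∧
      (∀ τ, X (τ + 4 * Real.pi * M) = X τ + 2) ∧
      (∀ τ, C 0 (τ + 4 * Real.pi * M) = C 0 τ + 2) ∧
      (∀ i, 1 ≤ i → ∀ τ, C i (τ + 4 * Real.pi * M) = C i τ) ∧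
      (∀ i τ, G i (τ + 4 * Real.pi * M) = G i τ) ∧
      (∀ i < r, ∀ τ, HasDerivAt (C i) (deriv X τ * C (i + 1) τ) τ) ∧
      (∀ i < r, ∀ τ, HasDerivAt (G i) (deriv X τ * G (i + 1) τ) τ) ∧
      (∀ τ, |X τ - τ / (2 * Real.pi * M)| ≤ 2) ∧
      (∀ τ, |C 0 τ - τ / (2 * Real.pi * M)| ≤ 2) ∧
      (∀ i, 1 ≤ i → i ≤ r → ∀ τ, |C i τ| ≤ K / M) ∧
      (∀ τ, |G 0 τ| ≤ K) ∧
      (∀ i, 1 ≤ i → i ≤ r → ∀ τ, |G i τ| ≤ K / M) ∧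
      (∀ a b : ℝ, a < b → ∃ c, a < c ∧ c < b ∧ deriv X c ≠ 0) ∧
      (∀ a b : ℝ, a < b → X a = X b → 0 < |C 0 a - C 0 b| ∧ |C 0 a - C 0 b| ≤ |G 0 a - G 0 b|) := by
  obtain ⟨c, hc, hI⟩ := int_lower r hr
  obtain ⟨E, hE, hE1, hEd⟩ := tower r _ (TP.s1.pow 2)
  obtain ⟨F, hF, hF1, hFd⟩ := tower r _ TP.s1
  choose KE hKE0 hKE using fun i => (hE i).bdd
  choose KF hKF0 hKF using fun i => (hF i).bdd
  have hTg : TP (fun M τ => Real.sin (τ / (2 * M)) * Xd M τ ^ (2 * r)) := TP.s1.mul (Xd_TP.pow _)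
  have hTc : TP (fun M τ => Real.sin (τ / (2 * M)) ^ 2 * Xd M τ ^ (2 * r)) :=
    (TP.s1.pow 2).mul (Xd_TP.pow _)
  obtain ⟨K0, hK00, hK0⟩ := hTg.bdd
  have hpi := Real.pi_pos
  set K := 1 + 2 / c * (K0 * (4 * Real.pi)) + 2 / c * ∑ i ∈ Finset.range (r + 1), (KE i + KF i) with hK
  have hsum0 : 0 ≤ ∑ i ∈ Finset.range (r + 1), (KE i + KF i) :=
    Finset.sum_nonneg fun i _ => add_nonneg (hKE0 i) (hKF0 i)
  have hKpos : 0 < K := by positivity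
  refine ⟨K, hKpos, fun M hM => ?_⟩
  have hM1 : 1 ≤ M := by omega
  have hM' : (0 : ℝ) < M := by exact_mod_cast hM1
  set p := 4 * Real.pi * M with hp
  have hp0 : 0 < p := by positivity
  set fc : ℝ → ℝ := fun τ => Real.sin (τ / (2 * M)) ^ 2 * Xd M τ ^ (2 * r) with hfc
  set fg : ℝ → ℝ := fun τ => Real.sin (τ / (2 * M)) * Xd M τ ^ (2 * r) with hfg
  have hfcs : ContDiff ℝ (⊤ : ℕ∞) fc := hTc.smooth M
  have hfgs : ContDiff ℝ (⊤ : ℕ∞) fg := hTg.smooth M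
  have hfcc := hfcs.continuous
  have hfgc := hfgs.continuous
  have hfcp : Function.Periodic fc p := fun τ => hTc.per M hM1 τ
  have hfgp : Function.Periodic fg p := fun τ => hTg.per M hM1 τ
  have hfc0 : ∀ τ, 0 ≤ fc τ := fun τ => mul_nonneg (sq_nonneg _) (by rw [pow_mul']; positivity)
  set I := ∫ τ in (0 : ℝ)..p, fc τ with hIdef
  have hIM : c * M ≤ I := hI M hM
  have hI0 : 0 < I := lt_of_lt_of_le (by positivity) hIM
  set κ := 2 / I with hκ
  have hκ0 : 0 < κ := by positivity
  have hκM : κ ≤ 2 / c / M := by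
    rw [hκ, div_div]; exact div_le_div_of_nonneg_left (by norm_num) (by positivity) hIM
  have prim : ∀ f : ℝ → ℝ, Continuous f → ∀ τ, HasDerivAt (fun τ => κ * ∫ x in (0 : ℝ)..τ, f x) (κ * f τ) τ :=
    fun f hf τ => (intervalIntegral.integral_hasDerivAt_right (hf.intervalIntegrable _ _)
      (hf.stronglyMeasurableAtFilter _ _) hf.continuousAt).const_mul κ
  have prims : ∀ f : ℝ → ℝ, ContDiff ℝ (⊤ : ℕ∞) f →
      ContDiff ℝ (⊤ : ℕ∞) (fun τ => κ * ∫ x in (0 : ℝ)..τ, f x) := by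
    intro f hf
    rw [contDiff_infty_iff_deriv]
    refine ⟨fun τ => (prim f hf.continuous τ).differentiableAt, ?_⟩
    rw [funext fun τ => (prim f hf.continuous τ).deriv]
    exact contDiff_const.mul hf
  have primp : ∀ f : ℝ → ℝ, Continuous f → Function.Periodic f p → ∀ τ,
      (κ * ∫ x in (0 : ℝ)..(τ + p), f x) = (κ * ∫ x in (0 : ℝ)..τ, f x) + κ * ∫ x in (0 : ℝ)..p, f x := by
    intro f hf hfp τ
    rw [← intervalIntegral.integral_add_adjacent_intervals (hf.intervalIntegrable 0 τ)
      (hf.intervalIntegrable τ (τ + p)), hfp.intervalIntegral_add_eq τ 0, zero_add, mul_add]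
  have hfgI : ∫ x in (0 : ℝ)..p, fg x = 0 := by
    have h1 := intervalIntegral.integral_add_adjacent_intervals
      (hfgc.intervalIntegrable (μ := MeasureTheory.volume) 0 (2 * Real.pi * M))
      (hfgc.intervalIntegrable (2 * Real.pi * M) p)
    have h2 := intervalIntegral.integral_comp_add_right (a := 0) (b := 2 * Real.pi * M) fg (2 * Real.pi * M)
    rw [show 2 * Real.pi * M + 2 * Real.pi * M = p by rw [hp]; ring, zero_add] at h2
    rw [← h1, ← h2]
    have h3 : ∀ x, fg (x + 2 * Real.pi * M) = - fg x := fun x => anti_s1 M hM1 r x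
    simp only [h3]
    rw [intervalIntegral.integral_neg]; ring
  have hXd : ∀ τ, deriv (Xz M) τ = Xd M τ := fun τ => (Xz_deriv M τ).deriv
  set C : ℕ → ℝ → ℝ := fun i τ => if i = 0 then κ * ∫ x in (0 : ℝ)..τ, fc x else κ * E i M τ with hC
  set G : ℕ → ℝ → ℝ := fun i τ => if i = 0 then κ * ∫ x in (0 : ℝ)..τ, fg x else κ * F i M τ with hG
  have hC0 : C 0 = fun τ => κ * ∫ x in (0 : ℝ)..τ, fc x := by simp [hC]
  have hG0 : G 0 = fun τ => κ * ∫ x in (0 : ℝ)..τ, fg x := by simp [hG]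
  have hCi : ∀ i, 1 ≤ i → C i = fun τ => κ * E i M τ := by
    intro i hi; funext τ; simp [hC, show i ≠ 0 by omega]
  have hGi : ∀ i, 1 ≤ i → G i = fun τ => κ * F i M τ := by
    intro i hi; funext τ; simp [hG, show i ≠ 0 by omega]
  have hpow : ∀ y : ℝ, y ^ (2 * r) = y * y ^ (2 * r - 1) := by
    intro y; rw [← pow_succ']; congr 1; omega
  have hKi : ∀ i ≤ r, 2 / c * (KE i + KF i) ≤ K := by
    intro i hi
    have : KE i + KF i ≤ ∑ i ∈ Finset.range (r + 1), (KE i + KF i) :=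
      Finset.single_le_sum (f := fun i => KE i + KF i) (fun i _ => add_nonneg (hKE0 i) (hKF0 i))
        (by simp; omega)
    have h2 : 2 / c * (KE i + KF i) ≤ 2 / c * ∑ i ∈ Finset.range (r + 1), (KE i + KF i) := by gcongr
    have h3 : 0 ≤ 2 / c * (K0 * (4 * Real.pi)) := by positivity
    linarith
  have hbd : ∀ i ≤ r, ∀ y, |y| ≤ KE i + KF i → |κ * y| ≤ K / M := by
    intro i hi y hy
    rw [abs_mul, abs_of_pos hκ0]
    calc κ * |y| ≤ 2 / c / M * (KE i + KF i) := by gcongr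
      _ = (2 / c * (KE i + KF i)) / M := by ring
      _ ≤ K / M := by gcongr; exact hKi i hi
  -- density
  have hdense : ∀ a b : ℝ, a < b → ∃ d, a < d ∧ d < b ∧ fc d ≠ 0 := by
    intro a b hab
    by_contra! hcon
    have hz : fc = 0 := by
      have han : AnalyticOnNhd ℝ fc Set.univ := hTc.analytic M
      refine han.eq_of_eventuallyEq (z₀ := (a + b) / 2) (g := 0) (fun x _ => analyticAt_const) ?_
      filter_upwards [Ioo_mem_nhds (show a < (a + b) / 2 by linarith) (show (a + b) / 2 < b by linarith)]
        with x hx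
      exact hcon x hx.1 hx.2
    rw [hIdef, hz] at hI0
    simp at hI0
  have hCd : ∀ τ, HasDerivAt (C 0) (κ * fc τ) τ := by rw [hC0]; exact prim fc hfcc
  have hGd : ∀ τ, HasDerivAt (G 0) (κ * fg τ) τ := by rw [hG0]; exact prim fg hfgc
  have hCmono : Monotone (C 0) := by
    refine monotone_of_deriv_nonneg (fun τ => (hCd τ).differentiableAt) fun τ => ?_
    rw [(hCd τ).deriv]
    exact mul_nonneg hκ0.le (hfc0 τ)
  have hCstrict : ∀ a b, a < b → C 0 a < C 0 b := by
    intro a b hab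
    refine lt_of_le_of_ne (hCmono hab.le) fun heq => ?_
    obtain ⟨d, had, hdb, hd⟩ := hdense a b hab
    have h1 : C 0 =ᶠ[nhds d] fun _ => C 0 a := by
      filter_upwards [Ioo_mem_nhds had hdb] with x hx
      exact le_antisymm ((hCmono hx.2.le).trans heq.ge) (hCmono hx.1.le)
    have h2 := h1.deriv_eq
    rw [(hCd d).deriv, deriv_const] at h2
    exact (mul_ne_zero hκ0.ne' hd) h2
  have hCper : ∀ τ, C 0 (τ + p) = C 0 τ + 2 := by
    intro τ
    rw [hC0]
    simp only
    rw [primp fc hfcc hfcp]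
    congr 1
    rw [hκ, ← hIdef]
    field_simp
  have hGper : ∀ τ, G 0 (τ + p) = G 0 τ := by
    intro τ
    rw [hG0]
    simp only
    rw [primp fg hfgc hfgp, hfgI]
    simp
  refine ⟨Xz M, C, G, ?_, ?_, ?_, Xz_per M hM1, hCper, ?_, ?_, ?_, ?_, ?_, ?_, ?_, ?_, ?_, ?_, ?_⟩
  · rw [contDiff_infty_iff_deriv]
    refine ⟨fun τ => (Xz_deriv M τ).differentiableAt, ?_⟩
    rw [funext hXd]; exact Xd_TP.smooth M
  · intro i
    rcases Nat.eq_zero_or_pos i with rfl | hi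
    · rw [hC0]; exact prims fc hfcs
    · rw [hCi i hi]; exact contDiff_const.mul ((hE i).smooth M)
  · intro i
    rcases Nat.eq_zero_or_pos i with rfl | hi
    · rw [hG0]; exact prims fg hfgs
    · rw [hGi i hi]; exact contDiff_const.mul ((hF i).smooth M)
  · intro i hi τ
    rw [hCi i hi]
    simp only [hp, (hE i).per M hM1]
  · intro i τ
    rcases Nat.eq_zero_or_pos i with rfl | hi
    · exact hGper τ
    · rw [hGi i hi]
      simp only [hp, (hF i).per M hM1]
  · intro i hi τ
    rw [hXd]
    rcases Nat.eq_zero_or_pos i with rfl | hi1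
    · refine (hCd τ).congr_deriv ?_
      rw [hCi _ (by omega)]
      simp only [zero_add, hE1, hfc]
      rw [hpow]; ring
    · rw [hCi i hi1, hCi (i + 1) (by omega)]
      exact ((hEd i hi1 hi M τ).const_mul κ).congr_deriv (by ring)
  · intro i hi τ
    rw [hXd]
    rcases Nat.eq_zero_or_pos i with rfl | hi1
    · refine (hGd τ).congr_deriv ?_
      rw [hGi _ (by omega)]
      simp only [zero_add, hF1, hfg]
      rw [hpow]; ring
    · rw [hGi i hi1, hGi (i + 1) (by omega)]
      exact ((hFd i hi1 hi M τ).const_mul κ).congr_deriv (by ring)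
  · intro τ; exact (Xz_close M τ).trans (by norm_num)
  · intro τ
    have hper : Function.Periodic (fun τ => C 0 τ - τ / (2 * Real.pi * M)) p := by
      intro τ
      simp only [hCper]
      rw [hp]; field_simp; ring
    obtain ⟨y, hy, hyy⟩ := hper.exists_mem_Ico₀ hp0 τ
    rw [hyy]
    have h0 : C 0 0 = 0 := by rw [hC0]; simp
    have h1 : 0 ≤ C 0 y := by rw [← h0]; exact hCmono hy.1
    have h2 : C 0 y ≤ 2 := by
      have := hCper 0
      rw [h0, zero_add, zero_add] at this
      rw [← this]; exact hCmono hy.2.le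
    have h3 : 0 ≤ y / (2 * Real.pi * M) := div_nonneg hy.1 (by positivity)
    have h4 : y / (2 * Real.pi * M) ≤ 2 := by
      rw [div_le_iff₀ (by positivity)]; have := hy.2; rw [hp] at this; linarith
    rw [abs_le]; constructor <;> linarith
  · intro i hi hir τ
    rw [hCi i hi]
    exact hbd i hir _ ((hKE i M τ).trans (by linarith [hKF0 i]))
  · intro τ
    have hper : Function.Periodic (G 0) p := hGper
    obtain ⟨y, hy, hyy⟩ := hper.exists_mem_Ico₀ hp0 τ
    rw [hyy, hG0]
    simp only
    have h1 : |∫ x in (0 : ℝ)..y, fg x| ≤ K0 * p := by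
      have := intervalIntegral.norm_integral_le_of_norm_le_const (a := 0) (b := y) (f := fg) (C := K0)
        (fun x _ => hK0 M x)
      rw [sub_zero, abs_of_nonneg hy.1] at this
      refine this.trans ?_
      have := hy.2.le
      gcongr
    rw [abs_mul, abs_of_pos hκ0]
    calc κ * |∫ x in (0 : ℝ)..y, fg x| ≤ 2 / c / M * (K0 * p) := by gcongr
      _ = 2 / c * (K0 * (4 * Real.pi)) := by rw [hp]; field_simp
      _ ≤ K := by
        have : 0 ≤ 2 / c * ∑ i ∈ Finset.range (r + 1), (KE i + KF i) := by positivity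
        linarith
  · intro i hi hir τ
    rw [hGi i hi]
    exact hbd i hir _ ((hKF i M τ).trans (by linarith [hKE0 i]))
  · intro a b hab
    obtain ⟨d, h1, h2, h3⟩ := hdense a b hab
    refine ⟨d, h1, h2, ?_⟩
    rw [hXd]
    intro h
    apply h3
    simp only [hfc, h]
    rw [zero_pow (by omega), mul_zero]
  · intro a b hab hXab
    have hlt := hCstrict a b hab
    have habs : |C 0 a - C 0 b| = C 0 b - C 0 a := by rw [abs_sub_comm, abs_of_pos (by linarith)]
    refine ⟨by rw [habs]; linarith, ?_⟩
    have hfl : ⌊a / (2 * Real.pi * M)⌋ = ⌊b / (2 * Real.pi * M)⌋ := by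
      rw [← Xz_floor M hM1, ← Xz_floor M hM1, hXab]
    set j := ⌊a / (2 * Real.pi * M)⌋ with hj
    have hmon : MonotoneOn (fun τ => ((-1 : ℝ) ^ j) * G 0 τ - C 0 τ) (Set.Icc a b) := by
      have hd : ∀ τ, HasDerivAt (fun τ => ((-1 : ℝ) ^ j) * G 0 τ - C 0 τ)
          ((-1 : ℝ) ^ j * (κ * fg τ) - κ * fc τ) τ := fun τ => ((hGd τ).const_mul _).sub (hCd τ)
      refine monotoneOn_of_deriv_nonneg (convex_Icc a b)
        (fun τ _ => (hd τ).continuousAt.continuousWithinAt)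
        (fun τ _ => (hd τ).differentiableAt.differentiableWithinAt) ?_
      intro τ hτ
      rw [interior_Icc] at hτ
      rw [(hd τ).deriv]
      have hT : (0 : ℝ) < 2 * Real.pi * M := by positivity
      have h1 : (j : ℝ) ≤ τ / (2 * Real.pi * M) :=
        (Int.floor_le _).trans (div_le_div_of_nonneg_right hτ.1.le hT.le)
      have h2 : τ / (2 * Real.pi * M) ≤ j + 1 := by
        refine (div_le_div_of_nonneg_right hτ.2.le hT.le).trans ?_
        rw [hfl]; exact (Int.lt_floor_add_one _).le
      have e : τ / (2 * M) - j * Real.pi = Real.pi * (τ / (2 * Real.pi * M) - j) := by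
        field_simp
      have hs := Real.sin_sub_int_mul_pi (τ / (2 * M)) j
      set σ := Real.sin (τ / (2 * M) - j * Real.pi) with hσ
      have hσ0 : 0 ≤ σ := by
        rw [hσ, e]
        exact Real.sin_nonneg_of_nonneg_of_le_pi (mul_nonneg hpi.le (by linarith)) (by nlinarith)
      have hσ1 : σ ≤ 1 := Real.sin_le_one _
      have hsq : Real.sin (τ / (2 * M)) ^ 2 = σ ^ 2 := by
        rw [hs, mul_pow, ← zpow_natCast ((-1 : ℝ) ^ j), ← zpow_mul, mul_comm j, zpow_mul]
        simp
      have e2 : (-1 : ℝ) ^ j * (κ * fg τ) - κ * fc τ = κ * (Xd M τ ^ (2 * r) * (σ - σ ^ 2)) := by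
        simp only [hfg, hfc]
        rw [hsq, hs]; ring
      rw [e2]
      have h5 : 0 ≤ σ - σ ^ 2 := by nlinarith
      have h6 : 0 ≤ Xd M τ ^ (2 * r) := by rw [pow_mul']; positivity
      positivity
    have h := hmon (Set.left_mem_Icc.2 hab.le) (Set.right_mem_Icc.2 hab.le) hab.le
    simp only at h
    have h2 : C 0 b - C 0 a ≤ (-1 : ℝ) ^ j * (G 0 b - G 0 a) := by linarith
    rw [habs]
    refine h2.trans ((le_abs_self _).trans ?_)
    rw [abs_mul, abs_zpow, abs_neg, abs_one, one_zpow, one_mul, abs_sub_comm]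


lemma iter_shift (f : ℝ → ℝ) (p d : ℝ) (h : ∀ τ, f (τ + p) = f τ + d) (m : ℕ) (τ : ℝ) :
    f (τ + m * p) = f τ + m * d := by
  induction m with
  | zero => simp
  | succ k ih =>
    push_cast
    rw [show τ + (k + 1) * p = (τ + k * p) + p by ring, h, ih]; ring

lemma base_curve (r : ℕ) (hr : 1 ≤ r) (δ B : ℝ) (hδ : 0 < δ) (hB : 0 ≤ B) :
    ∃ (x : ℝ → ℝ) (S H : ℕ → ℝ → ℝ), ContDiff ℝ (⊤ : ℕ∞) x ∧
      (∀ i, ContDiff ℝ (⊤ : ℕ∞) (S i)) ∧ (∀ i, ContDiff ℝ (⊤ : ℕ∞) (H i)) ∧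
      (∀ t, x (t + 1) = x t + 1) ∧ (∀ t, S 0 (t + 1) = S 0 t + 1) ∧
      (∀ i, 1 ≤ i → ∀ t, S i (t + 1) = S i t) ∧ (∀ i t, H i (t + 1) = H i t) ∧
      (∀ i < r, ∀ t, deriv (S i) t = deriv x t * S (i + 1) t) ∧
      (∀ i < r, ∀ t, deriv (H i) t = deriv x t * H (i + 1) t) ∧
      (∀ t, |x t - t| < δ) ∧ (∀ t, |S 0 t - t| < δ) ∧ (∀ i, 1 ≤ i → ∀ t, |S i t| < δ) ∧
      (∀ i t, |H i t| < δ) ∧ (∀ i, r < i → ∀ t, S i t = 0) ∧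
      Dense {t : ℝ | deriv x t ≠ 0} ∧
      (∀ t s, t < s → x t = x s → B * |S 0 t - S 0 s| < |H 0 t - H 0 s|) := by
  obtain ⟨K, hK, hz⟩ := zigzag r hr
  set η := δ / (2 * K) with hη
  have hη0 : 0 < η := by positivity
  obtain ⟨m, hm⟩ := exists_nat_gt (max 1 (max (2 / δ) ((B + 1) / η)))
  have hm1 : (1 : ℝ) < m := lt_of_le_of_lt (le_max_left _ _) hm
  have hm2 : 2 / δ < m := lt_of_le_of_lt ((le_max_left _ _).trans (le_max_right _ _)) hm
  have hm3 : (B + 1) / η < m := lt_of_le_of_lt ((le_max_right _ _).trans (le_max_right _ _)) hm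
  rw [div_lt_iff₀ hδ] at hm2
  rw [div_lt_iff₀ hη0] at hm3
  set n : ℝ := 2 * m with hn
  have hn1 : 1 ≤ n := by linarith
  have hn0 : 0 < n := by linarith
  obtain ⟨M, hM⟩ := exists_nat_gt (max 128 (max (n ^ r * K / δ) (η * n ^ r * K / δ)))
  have hM1 : (128 : ℝ) < M := lt_of_le_of_lt (le_max_left _ _) hM
  have hM2 : n ^ r * K / δ < M := lt_of_le_of_lt ((le_max_left _ _).trans (le_max_right _ _)) hM
  have hM3 : η * n ^ r * K / δ < M := lt_of_le_of_lt ((le_max_right _ _).trans (le_max_right _ _)) hM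
  have hM0 : (0 : ℝ) < M := by linarith
  rw [div_lt_iff₀ hδ] at hM2 hM3
  have hb1 : n ^ r * (K / M) < δ := by
    rw [← mul_div_assoc, div_lt_iff₀ hM0]; linarith
  have hb2 : η * (n ^ r * (K / M)) < δ := by
    rw [← mul_div_assoc, ← mul_div_assoc, div_lt_iff₀ hM0]; linarith
  obtain ⟨X, C, G, hX, hC, hG, hXp, hC0p, hCp, hGp, hCd, hGd, hXt, hC0t, hCb, hG0b, hGb, hden, hinj⟩ :=
    hz M (by exact_mod_cast hM1.le)
  have hpi := Real.pi_pos
  set N : ℝ := m * (4 * Real.pi * M) with hN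
  have hN0 : 0 < N := by positivity
  have hNt : ∀ t, N * t / (2 * Real.pi * M) = n * t := by
    intro t; rw [hN, hn]; field_simp; ring
  have hshift : ∀ t, N * (t + 1) = N * t + m * (4 * Real.pi * M) := by intro t; rw [hN]; ring
  have hXd : ∀ τ, HasDerivAt X (deriv X τ) τ := fun τ =>
    ((hX.differentiable (by simp)) τ).hasDerivAt
  have hlin : ∀ t, HasDerivAt (fun t : ℝ => N * t) N t := fun t => by
    simpa using (hasDerivAt_id t).const_mul N
  have hlins : ContDiff ℝ (⊤ : ℕ∞) (fun t : ℝ => N * t) := contDiff_const.mul contDiff_id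
  have hxd : ∀ t, HasDerivAt (fun t => X (N * t) / n) (deriv X (N * t) * N / n) t := fun t =>
    ((hXd (N * t)).comp t (hlin t)).div_const n
  set S : ℕ → ℝ → ℝ := fun i t => if i ≤ r then n ^ i / n * C i (N * t) else 0 with hS
  set H : ℕ → ℝ → ℝ := fun i t => if i ≤ r then η * n ^ i * G i (N * t) else 0 with hH
  have hSi : ∀ i, i ≤ r → S i = fun t => n ^ i / n * C i (N * t) := by
    intro i hi; funext t; simp [hS, hi]
  have hHi : ∀ i, i ≤ r → H i = fun t => η * n ^ i * G i (N * t) := by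
    intro i hi; funext t; simp [hH, hi]
  have hSz : ∀ i, r < i → S i = fun t => 0 := by
    intro i hi; funext t; simp [hS, not_le.2 hi]
  have hHz : ∀ i, r < i → H i = fun t => 0 := by
    intro i hi; funext t; simp [hH, not_le.2 hi]
  have hS0 : ∀ t, S 0 t = C 0 (N * t) / n := by
    intro t; rw [hSi 0 (by omega)]; simp only [pow_zero]; ring
  have hH0 : ∀ t, H 0 t = η * G 0 (N * t) := by
    intro t; rw [hHi 0 (by omega)]; simp only [pow_zero]; ring
  have hclose : ∀ (y t : ℝ), |y - N * t / (2 * Real.pi * M)| ≤ 2 → |y / n - t| < δ := by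
    intro y t hy
    rw [hNt] at hy
    have : y / n - t = (y - n * t) / n := by field_simp
    rw [this, abs_div, abs_of_pos hn0, div_lt_iff₀ hn0]
    rw [hn]; nlinarith
  have hnp : ∀ i, i ≤ r → n ^ i ≤ n ^ r := fun i hi => pow_le_pow_right₀ hn1 hi
  have hKM : 0 < K / M := by positivity
  refine ⟨fun t => X (N * t) / n, S, H, ?_, ?_, ?_, ?_, ?_, ?_, ?_, ?_, ?_, ?_, ?_, ?_, ?_, ?_, ?_, ?_⟩
  · exact (hX.comp hlins).div_const n
  · intro i
    by_cases hi : i ≤ r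
    · rw [hSi i hi]; exact contDiff_const.mul ((hC i).comp hlins)
    · rw [hSz i (by omega)]; exact contDiff_const
  · intro i
    by_cases hi : i ≤ r
    · rw [hHi i hi]; exact contDiff_const.mul ((hG i).comp hlins)
    · rw [hHz i (by omega)]; exact contDiff_const
  · intro t
    simp only
    rw [hshift, iter_shift X _ 2 hXp, add_div]
    congr 1
    rw [hn]; field_simp
  · intro t
    rw [hS0, hS0, hshift, iter_shift (C 0) _ 2 hC0p, add_div]
    congr 1
    rw [hn]; field_simp
  · intro i hi t
    by_cases hir : i ≤ r
    · rw [hSi i hir]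
      simp only
      rw [hshift, iter_shift (C i) _ 0 (by simpa using hCp i hi)]; simp
    · rw [hSz i (by omega)]
  · intro i t
    by_cases hir : i ≤ r
    · rw [hHi i hir]
      simp only
      rw [hshift, iter_shift (G i) _ 0 (by simpa using hGp i)]; simp
    · rw [hHz i (by omega)]
  · intro i hi t
    rw [(hxd t).deriv, hSi i hi.le, hSi (i + 1) hi]
    have hd : HasDerivAt (fun t => n ^ i / n * C i (N * t))
        (n ^ i / n * (deriv X (N * t) * C (i + 1) (N * t) * N)) t :=
      ((hCd i hi (N * t)).comp t (hlin t)).const_mul (n ^ i / n)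
    rw [hd.deriv]
    simp only
    rw [pow_succ]; field_simp
  · intro i hi t
    rw [(hxd t).deriv, hHi i hi.le, hHi (i + 1) hi]
    have hd : HasDerivAt (fun t => η * n ^ i * G i (N * t))
        (η * n ^ i * (deriv X (N * t) * G (i + 1) (N * t) * N)) t :=
      ((hGd i hi (N * t)).comp t (hlin t)).const_mul (η * n ^ i)
    rw [hd.deriv]
    simp only
    rw [pow_succ]; field_simp
  · intro t; exact hclose _ t (hXt _)
  · intro t; rw [hS0]; exact hclose _ t (hC0t _)
  · intro i hi t
    by_cases hir : i ≤ r
    · rw [hSi i hir]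
      simp only
      rw [abs_mul, abs_of_pos (by positivity)]
      refine lt_of_le_of_lt ?_ hb1
      have h1 : n ^ i / n ≤ n ^ r := (div_le_self (by positivity) hn1).trans (hnp i hir)
      exact mul_le_mul h1 (hCb i hi hir _) (abs_nonneg _) (by positivity)
    · rw [hSz i (by omega)]; simpa using hδ
  · intro i t
    by_cases hir : i ≤ r
    · rcases Nat.eq_zero_or_pos i with rfl | hi
      · rw [hH0, abs_mul, abs_of_pos hη0]
        have h1 : η * |G 0 (N * t)| ≤ η * K := mul_le_mul_of_nonneg_left (hG0b _) hη0.le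
        have h2 : η * K = δ / 2 := by rw [hη]; field_simp
        linarith
      · rw [hHi i hir]
        simp only
        rw [abs_mul, abs_of_pos (by positivity), mul_assoc]
        refine lt_of_le_of_lt ?_ hb2
        refine mul_le_mul_of_nonneg_left ?_ hη0.le
        exact mul_le_mul (hnp i hir) (hGb i hi hir _) (abs_nonneg _) (by positivity)
    · rw [hHz i (by omega)]; simpa using hδ
  · intro i hi t; rw [hSz i hi]
  · apply dense_of_exists_between
    intro a b hab
    obtain ⟨c, h1, h2, h3⟩ := hden (N * a) (N * b) (mul_lt_mul_of_pos_left hab hN0)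
    refine ⟨c / N, ?_, ?_, ?_⟩
    · simp only [Set.mem_ofPred_eq]
      rw [(hxd _).deriv, mul_div_cancel₀ _ hN0.ne']
      positivity
    · rw [lt_div_iff₀ hN0]; linarith
    · rw [div_lt_iff₀ hN0]; linarith
  · intro t s hts hx
    have hx' : X (N * t) = X (N * s) := by
      simp only at hx
      exact (div_left_inj' hn0.ne').1 hx
    obtain ⟨h1, h2⟩ := hinj _ _ (mul_lt_mul_of_pos_left hts hN0) hx'
    rw [hS0, hS0, hH0, hH0, ← sub_div, ← mul_sub, abs_div, abs_of_pos hn0, abs_mul, abs_of_pos hη0,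
      ← mul_div_assoc, div_lt_iff₀ hn0]
    set u := |C 0 (N * t) - C 0 (N * s)|
    set v := |G 0 (N * t) - G 0 (N * s)|
    have h3 : B * u < (n * η) * u := by
      apply mul_lt_mul_of_pos_right _ h1
      rw [hn]; nlinarith
    have h4 : (n * η) * u ≤ (n * η) * v := mul_le_mul_of_nonneg_left h2 (by positivity)
    linarith

lemma smoothing (f : ℝ → ℝ) (hf : Continuous f) (hp : ∀ t, f (t + 1) = f t) (ε : ℝ) (hε : 0 < ε) :
    ∃ s : ℝ → ℝ, ContDiff ℝ (⊤ : ℕ∞) s ∧ (∀ t, s (t + 1) = s t) ∧ ∀ t, |s t - f t| < ε := by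
  have hper : Function.Periodic f 1 := hp
  -- uniform continuity
  have huc : ∃ d > 0, ∀ x y : ℝ, |x - y| < d → |f x - f y| < ε / 2 := by
    have h1 := (isCompact_Icc (a := (-1 : ℝ)) (b := 2)).uniformContinuousOn_of_continuous hf.continuousOn
    rw [Metric.uniformContinuousOn_iff] at h1
    obtain ⟨d, hd, h⟩ := h1 (ε / 2) (by linarith)
    refine ⟨min d 1, by positivity, fun x y hxy => ?_⟩
    have e1 := hper.sub_int_mul_eq (x := x) ⌊x⌋
    have e2 := hper.sub_int_mul_eq (x := y) ⌊x⌋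
    have h2 := Int.floor_le x
    have h3 := Int.lt_floor_add_one x
    have h4 := abs_lt.1 (lt_of_lt_of_le hxy (min_le_right _ _))
    have := h (x - ⌊x⌋ * 1) ⟨by linarith, by linarith⟩ (y - ⌊x⌋ * 1) ⟨by linarith, by linarith⟩ (by
      rw [Real.dist_eq, sub_sub_sub_cancel_right]
      exact lt_of_lt_of_le hxy (min_le_left _ _))
    rwa [e1, e2, Real.dist_eq] at this
  obtain ⟨d, hd, hdd⟩ := huc
  let φ : ContDiffBump (0 : ℝ) := ⟨d / 2, d, by positivity, by linarith⟩
  refine ⟨MeasureTheory.convolution (φ.normed MeasureTheory.volume) f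
    (ContinuousLinearMap.lsmul ℝ ℝ) MeasureTheory.volume, ?_, ?_, ?_⟩
  · exact φ.hasCompactSupport_normed.contDiff_convolution_left _ φ.contDiff_normed
      hf.locallyIntegrable
  · intro t
    simp only [MeasureTheory.convolution_def]
    congr 1
    funext u
    rw [show t + 1 - u = (t - u) + 1 by ring, hp]
  · intro t
    have h := φ.dist_normed_convolution_le (μ := MeasureTheory.volume) (g := f) (x₀ := t) (ε := ε / 2)
      hf.aestronglyMeasurable (by
        intro x hx
        rw [Metric.mem_ball, Real.dist_eq] at hx
        rw [Real.dist_eq]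
        exact (hdd x t hx).le)
    rw [Real.dist_eq] at h
    linarith

/-- Holonomic approximation by multi-sections over the circle
(del Pino–Toussaint, Theorem 7.2 for `X = S¹` and the trivial bundle `S¹ × ℝ^ℓ`),
in elementary form over the universal cover. -/
theorem holonomic_approximation_over_circle
    (ℓ r : ℕ) (hℓ : 1 ≤ ℓ) (hr : 1 ≤ r) (ε : ℝ) (hε : 0 < ε)
    (σ : ℕ → ℝ → Vec ℓ)
    (hσcont : ∀ i ≤ r, Continuous (σ i))
    (hσper : ∀ i ≤ r, ∀ t : ℝ, σ i (t + 1) = σ i t) :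
    ∃ (x : ℝ → ℝ) (z : ℕ → ℝ → Vec ℓ),
      ContDiff ℝ (⊤ : ℕ∞) x ∧ (∀ i ≤ r, ContDiff ℝ (⊤ : ℕ∞) (z i)) ∧
      -- descends to the circle
      (∀ t : ℝ, x (t + 1) = x t + 1) ∧ (∀ i ≤ r, ∀ t : ℝ, z i (t + 1) = z i t) ∧
      -- (a) integrality
      (∀ i < r, ∀ t : ℝ, deriv (z i) t = deriv x t • z (i + 1) t) ∧
      -- (b) graphical on a dense set
      Dense {t : ℝ | deriv x t ≠ 0} ∧
      -- (c) the front is injective modulo ℤ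
      (∀ (t s : ℝ) (k : ℤ), x t = x s + k → z 0 t = z 0 s → t = s + k) ∧
      -- (d) approximation
      (∀ t : ℝ, |x t - t| < ε) ∧ (∀ i ≤ r, ∀ t : ℝ, ‖z i t - σ i t‖ < ε) := by
  have key : ∀ (i : ℕ) (c : Fin ℓ), ∃ s : ℝ → ℝ, ContDiff ℝ (⊤ : ℕ∞) s ∧ (∀ t, s (t + 1) = s t) ∧
      (i ≤ r → ∀ t, |s t - σ i t c| < ε / 3) := by
    intro i c
    by_cases hi : i ≤ r
    · obtain ⟨s, h1, h2, h3⟩ := smoothing (fun t => σ i t c)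
        ((continuous_apply c).comp (hσcont i hi)) (fun t => by simp only [hσper i hi t])
        (ε / 3) (by positivity)
      exact ⟨s, h1, h2, fun _ => h3⟩
    · exact ⟨fun _ => 0, contDiff_const, fun _ => rfl, fun h => absurd h hi⟩
  choose s hs1 hs2 hs3 using key
  have happ := fun c : Fin ℓ => scalar_approx r (fun i => s i c) (fun i => hs1 i c)
    (fun i => hs2 i c) (ε / 3) (by positivity)
  choose d hd0 hd using happ
  let c0 : Fin ℓ := ⟨0, by omega⟩
  obtain ⟨B, hB0, hB⟩ := lip_F r (fun i => s i c0) (fun i => hs1 i c0) (fun i => hs2 i c0)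
  have : Nonempty (Fin ℓ) := ⟨c0⟩
  obtain ⟨cm, hcm⟩ := Finite.exists_min d
  set δ := min (d cm) (min (ε / 3) (1 / 2)) with hδ
  have hδ0 : 0 < δ := lt_min (hd0 cm) (lt_min (by positivity) (by norm_num))
  have hδd : ∀ c, δ ≤ d c := fun c => (min_le_left _ _).trans (hcm c)
  have hδε : δ ≤ ε / 3 := (min_le_right _ _).trans (min_le_left _ _)
  have hδ1 : δ ≤ 1 / 2 := (min_le_right _ _).trans (min_le_right _ _)
  obtain ⟨x, S, H, hx, hS, hH, hxp, hS0p, hSp, hHp, hSd, hHd, hxt, hS0t, hSt, hHt, hSz, hdense, hinj⟩ :=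
    base_curve r hr δ B hδ0 hB0
  have hz := fun c : Fin ℓ => hd c x S hx hS hxp hS0p hSp hSd (fun t => (hxt t).trans_le (hδd c))
    (fun t => (hS0t t).trans_le (hδd c)) (fun i hi t => (hSt i hi t).trans_le (hδd c)) hSz
  choose z hz1 hz2 hz3 hz4 hz5 using hz
  have hper0 : ∀ (t : ℝ) (k : ℤ) (c : Fin ℓ), z c 0 (t + k) + H 0 (t + k) = z c 0 t + H 0 t := by
    intro t k c
    have h1 : Function.Periodic (z c 0) 1 := hz2 c 0
    have h2 : Function.Periodic (H 0) 1 := hHp 0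
    have h3 := h1.int_mul k t
    have h4 := h2.int_mul k t
    rw [mul_one] at h3 h4
    rw [h3, h4]
  have hxk : ∀ (t : ℝ) (k : ℤ), x (t + k) = x t + k := by
    intro t k
    have h1 : Function.Periodic (fun t => x t - t) 1 := by
      intro t; simp only [hxp]; ring
    have h3 := h1.int_mul k t
    rw [mul_one] at h3
    linarith
  -- injectivity on the line
  have hline : ∀ t u : ℝ, t < u → x t = x u → z c0 0 t + H 0 t ≠ z c0 0 u + H 0 u := by
    intro t u htu hxtu heq
    have h1 := hinj t u htu hxtu
    have hb : ∀ v, |x v - S 0 v| ≤ 1 := by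
      intro v
      have h2 := abs_lt.1 (hxt v)
      have h3 := abs_lt.1 (hS0t v)
      rw [abs_le]; constructor <;> linarith
    have h2 := hB (x t) (S 0 t) (S 0 u) (hb t) (by rw [hxtu]; exact hb u)
    have e1 := hz5 c0 t
    have e2 := hz5 c0 u
    rw [← hxtu] at e2
    rw [← e1, ← e2] at h2
    have h3 : z c0 0 t - z c0 0 u = -(H 0 t - H 0 u) := by linarith
    rw [h3, abs_neg] at h2
    linarith
  refine ⟨x, fun i t c => z c i t + H i t, hx, ?_, hxp, ?_, ?_, hdense, ?_, ?_, ?_⟩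
  · intro i _
    exact contDiff_pi.2 fun c => (hz1 c i).add (hH i)
  · intro i _ t
    funext c
    simp only [hz2, hHp]
  · intro i hi t
    have h : HasDerivAt (fun t => fun c : Fin ℓ => z c i t + H i t)
        (fun c => deriv (z c i) t + deriv (H i) t) t := by
      rw [hasDerivAt_pi]
      intro c
      exact (((hz1 c i).differentiable (by simp)) t).hasDerivAt.add
        (((hH i).differentiable (by simp)) t).hasDerivAt
    rw [h.deriv]
    funext c
    simp only [Pi.smul_apply, smul_eq_mul]
    rw [hz3 c i hi, hHd i hi]; ring
  · intro t u k hxk1 hz0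
    have h1 := congrFun hz0 c0
    simp only at h1
    rw [← hxk] at hxk1
    rw [← hper0 u k c0] at h1
    rcases lt_trichotomy t (u + k) with h | h | h
    · exact absurd h1 (hline _ _ h hxk1)
    · exact h
    · exact absurd h1.symm (hline _ _ h hxk1.symm)
  · intro t
    have := hxt t
    linarith
  · intro i hi t
    rw [pi_norm_lt_iff hε]
    intro c
    rw [Pi.sub_apply, Real.norm_eq_abs]
    have h1 := abs_lt.1 (hz4 c i hi t)
    have h2 := abs_lt.1 (hs3 i c hi t)
    have h3 := abs_lt.1 (hHt i t)
    rw [abs_lt]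
    constructor <;> linarith
end
end

section
/- (Lifting curves to integral curves in jet space; Subsection 5.3 of del Pino–Toussaint.) Fix integers ℓ ≥ 1 and r ≥ 1. Let x : ℝ → ℝ and w : ℝ → ℝ^ℓ be smooth, and let c_0, …, c_{r−1} ∈ ℝ^ℓ. Then there exists exactly one tuple of smooth maps z_0, …, z_r : ℝ → ℝ^ℓ such that z_r = w, z_i(0) = c_i for all 0 ≤ i ≤ r−1, and deriv z_i t = (deriv x t) • z_{i+1}(t) for all 0 ≤ i < r and all t ∈ ℝ. (Thus every smooth curve in the metasymplectic projection ℝ ⊕ Sym^r(ℝ,ℝ^ℓ) lifts uniquely, given initial values, to an integral curve of the Cartan distribution of J^r(ℝ,ℝ^ℓ).) -/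
noncomputable section

def liftAux {ℓ : ℕ} (r : ℕ) (x : ℝ → ℝ) (w : ℝ → Vec ℓ) (c : ℕ → Vec ℓ) : ℕ → ℝ → Vec ℓ
  | 0 => w
  | k + 1 => fun t => c (r - (k + 1)) + ∫ s in (0 : ℝ)..t, deriv x s • liftAux r x w c k s

theorem smooth_primitive {ℓ : ℕ} (g : ℝ → Vec ℓ) (hg : ContDiff ℝ (⊤ : ℕ∞) g) (a : Vec ℓ) :
    ContDiff ℝ (⊤ : ℕ∞) (fun t => a + ∫ s in (0 : ℝ)..t, g s) ∧
      ∀ t, deriv (fun t => a + ∫ s in (0 : ℝ)..t, g s) t = g t := by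
  have h : ∀ t, HasDerivAt (fun t => a + ∫ s in (0 : ℝ)..t, g s) (g t) t := fun t =>
    (hg.continuous.integral_hasStrictDerivAt 0 t).hasDerivAt.const_add a
  have hd : deriv (fun t => a + ∫ s in (0 : ℝ)..t, g s) = g := funext fun t => (h t).deriv
  refine ⟨contDiff_infty_iff_deriv.2 ⟨fun t => (h t).differentiableAt, ?_⟩, fun t => (h t).deriv⟩
  rw [hd]
  exact hg

theorem liftAux_smooth {ℓ : ℕ} (r : ℕ) (x : ℝ → ℝ) (hx : ContDiff ℝ (⊤ : ℕ∞) x)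
    (w : ℝ → Vec ℓ) (hw : ContDiff ℝ (⊤ : ℕ∞) w) (c : ℕ → Vec ℓ) (k : ℕ) :
    ContDiff ℝ (⊤ : ℕ∞) (liftAux r x w c k) := by
  induction k with
  | zero => exact hw
  | succ k ih => exact (smooth_primitive _ ((contDiff_infty_iff_deriv.1 hx).2.smul ih) _).1

/-- Lifting curves to integral curves in jet space
(del Pino–Toussaint, Subsection 5.3): every smooth curve in the metasymplectic
projection lifts uniquely, given initial values, to an integral curve of the
Cartan distribution of `J^r(ℝ, ℝ^ℓ)`. -/
theorem lifting_curves_to_integral_curves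
    (ℓ r : ℕ) (hℓ : 1 ≤ ℓ) (hr : 1 ≤ r)
    (x : ℝ → ℝ) (hx : ContDiff ℝ (⊤ : ℕ∞) x)
    (w : ℝ → Vec ℓ) (hw : ContDiff ℝ (⊤ : ℕ∞) w)
    (c : ℕ → Vec ℓ) :
    ∃ z : ℕ → ℝ → Vec ℓ,
      (∀ i ≤ r, ContDiff ℝ (⊤ : ℕ∞) (z i)) ∧
      z r = w ∧
      (∀ i < r, z i 0 = c i) ∧
      (∀ i < r, ∀ t : ℝ, deriv (z i) t = deriv x t • z (i + 1) t) ∧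
      -- uniqueness
      (∀ z' : ℕ → ℝ → Vec ℓ,
        (∀ i ≤ r, ContDiff ℝ (⊤ : ℕ∞) (z' i)) →
        z' r = w →
        (∀ i < r, z' i 0 = c i) →
        (∀ i < r, ∀ t : ℝ, deriv (z' i) t = deriv x t • z' (i + 1) t) →
        ∀ i ≤ r, z' i = z i) := by
  have hs := liftAux_smooth r x hx w hw c
  have h0 : ∀ i < r, liftAux r x w c (r - i) 0 = c i := by
    intro i hi
    obtain ⟨k, rfl⟩ : ∃ k, r = i + (k + 1) := ⟨r - i - 1, by omega⟩
    rw [show i + (k + 1) - i = k + 1 by omega]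
    simp [liftAux]
  have hD : ∀ i < r, ∀ t : ℝ, deriv (liftAux r x w c (r - i)) t
      = deriv x t • liftAux r x w c (r - (i + 1)) t := by
    intro i hi t
    rw [show r - i = (r - (i + 1)) + 1 by omega]
    exact (smooth_primitive _ ((contDiff_infty_iff_deriv.1 hx).2.smul (hs (r - (i + 1)))) _).2 t
  refine ⟨fun i => liftAux r x w c (r - i), fun i _ => hs _, ?_, h0, hD, ?_⟩
  · simp [liftAux]
  · intro z' hz hzr hz0 hzD
    have key : ∀ k ≤ r, z' (r - k) = liftAux r x w c k := by
      intro k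
      induction k with
      | zero => intro _; simpa [liftAux] using hzr
      | succ k ih =>
        intro hk
        have ih := ih (by omega)
        have hi : r - (k + 1) < r := by omega
        have e1 : r - (k + 1) + 1 = r - k := by omega
        have e2 : r - (r - (k + 1)) = k + 1 := by omega
        have e3 : r - (r - (k + 1) + 1) = k := by omega
        have d1 : Differentiable ℝ (z' (r - (k + 1))) :=
          (contDiff_infty_iff_deriv.1 (hz _ hi.le)).1
        have d2 : Differentiable ℝ (liftAux r x w c (k + 1)) :=
          (contDiff_infty_iff_deriv.1 (hs _)).1
        have hz0' := hz0 _ hi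
        have h0' := h0 _ hi
        rw [e2] at h0'
        have hc := is_const_of_deriv_eq_zero (d1.sub d2) (fun t => by
          have a := hzD _ hi t
          have b := hD _ hi t
          rw [e2, e3] at b
          rw [e1, ih] at a
          rw [deriv_sub (d1 t) (d2 t), a, b, sub_self])
        funext t
        have := hc t 0
        simp only [Pi.sub_apply, hz0', h0', sub_self] at this
        exact sub_eq_zero.1 this
    intro i hi
    have := key (r - i) (by omega)
    rwa [show r - (r - i) = i by omega] at this
end
end
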